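/- arXiv:1804.00187 — 5 statements merged into one kernel-verified Lean document; each statement's English description precedes it below -/
import Mathlib

section
/- Assume ∫_1^∞ φ(τ) dτ/τ = ∞ and ∫_1^∞ φ̃(τ) dτ/τ = ∞. Then H₁[φs, φ̃s̃](τ) = H[φ̃s̃, φs](τ)·(1 + o(1)) as τ → ∞, and consequently the almost Mellin convolution is asymptotically symmetric: (φs ∗ φ̃s̃)(τ) = (φ̃s̃ ∗ φs)(τ)·(1 + o(1)) as τ → ∞. -/
open MeasureTheory Filter Real Set Asymptotics

noncomputable section

/-- A function is *slowly varying at infinity* (SVF): it is positive on `(0, ∞)` and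
`φ(cτ)/φ(τ) → 1` as `τ → ∞` for every constant `c > 0`. -/
def IsSVF (φ : ℝ → ℝ) : Prop :=
  (∀ x > 0, 0 < φ x) ∧ ∀ c > 0, Tendsto (fun τ => φ (c * τ) / φ τ) atTop (nhds 1)

/-- Mellin convolution `(φ∗ψ)(τ) = ∫_1^τ φ(σ) ψ(τ/σ) dσ/σ`. -/
def mellinConv (φ ψ : ℝ → ℝ) (τ : ℝ) : ℝ :=
  ∫ σ in Set.Ioc (1:ℝ) τ, φ σ * ψ (τ / σ) / σ

/-- `h_{φ,ψ}(τ) = ∫_1^{√τ} φ(σ) ψ(τ/σ) dσ/σ`. -/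
def mellinH (φ ψ : ℝ → ℝ) (τ : ℝ) : ℝ :=
  ∫ σ in Set.Ioc (1:ℝ) (Real.sqrt τ), φ σ * ψ (τ / σ) / σ

/-- `μ` is the Lebesgue–Stieltjes measure generated by the (monotone) function
`σ ↦ ρ (ln σ)` on `(0, ∞)`. -/
def IsLogStieltjes (μ : MeasureTheory.Measure ℝ) (ρ : ℝ → ℝ) : Prop :=
  ∀ a b : ℝ, 0 < a → a ≤ b →
    μ (Set.Ioc a b) = ENNReal.ofReal (ρ (Real.log b) - ρ (Real.log a))

/-- `ν` is the Lebesgue–Stieltjes measure generated by the (monotone) function `ρ`. -/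
def IsStieltjesOf (ν : MeasureTheory.Measure ℝ) (ρ : ℝ → ℝ) : Prop :=
  ∀ a b : ℝ, a ≤ b → ν (Set.Ioc a b) = ENNReal.ofReal (ρ b - ρ a)

/-- The almost Mellin convolution integral
`∫_A φ(τ/σ) ψ(σ) s(ln(τ/σ)) s̃(ln σ) d(ρ̃(ln σ))/ρ̃(ln σ)` over a region `A`,
where `μ` is the Lebesgue–Stieltjes measure of `σ ↦ ρ̃(ln σ)`. -/
def almostMellinOn (A : Set ℝ) (φ ψ s st ρt : ℝ → ℝ) (μ : MeasureTheory.Measure ℝ)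
    (τ : ℝ) : ℝ :=
  ∫ σ in A, φ (τ / σ) * ψ σ * s (Real.log (τ / σ)) * st (Real.log σ) / ρt (Real.log σ) ∂μ

/-- `(φs ∗ ψs̃)(τ)`: the almost Mellin convolution over `(1, τ]`. -/
def almostMellin (φ ψ s st ρt : ℝ → ℝ) (μ : MeasureTheory.Measure ℝ) (τ : ℝ) : ℝ :=
  almostMellinOn (Set.Ioc 1 τ) φ ψ s st ρt μ τ

/-- `H[φs, ψs̃](τ)`: the almost Mellin convolution over `(1, √τ]`. -/
def almostH (φ ψ s st ρt : ℝ → ℝ) (μ : MeasureTheory.Measure ℝ) (τ : ℝ) : ℝ :=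
  almostMellinOn (Set.Ioc 1 (Real.sqrt τ)) φ ψ s st ρt μ τ

/-- `H₁[φs, ψs̃](τ)`: the almost Mellin convolution over `(√τ, τ]`. -/
def almostH1 (φ ψ s st ρt : ℝ → ℝ) (μ : MeasureTheory.Measure ℝ) (τ : ℝ) : ℝ :=
  almostMellinOn (Set.Ioc (Real.sqrt τ) τ) φ ψ s st ρt μ τ

/-- `(s ⋆ s̃)(η) = (1/T) ∫_0^T s(η − λ) s̃(λ) dλ`. -/
def periodConv (s st : ℝ → ℝ) (T η : ℝ) : ℝ :=
  (1 / T) * ∫ l in (0:ℝ)..T, s (η - l) * st l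

/-- The eigenvalue counting function `N(t) = #{n : λ_n > t}` of a sequence. -/
def cntF (lam : ℕ → ℝ) (t : ℝ) : ℝ := (Nat.card {n : ℕ | t < lam n} : ℝ)

/-- The counting function `N_⊗(t) = #{(k, j) : λ_k λ̃_j > t}` of the tensor product. -/
def cntTensor (lam lamt : ℕ → ℝ) (t : ℝ) : ℝ :=
  (Nat.card {q : ℕ × ℕ | t < lam q.1 * lamt q.2} : ℝ)

/-- `s_⊗(η) = (1/p)(s ⋆ s̃)(η) + (s ⋆ s̃)'(η)`. -/
def sOtimes (p T : ℝ) (s st : ℝ → ℝ) (η : ℝ) : ℝ :=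
  (1 / p) * periodConv s st T η + deriv (periodConv s st T) η

/-- `m_ψ(σ) = sup_{τ > σ²} ψ(τ/σ)/ψ(τ)`. -/
def mSup (ψ : ℝ → ℝ) (σ : ℝ) : ℝ :=
  sSup {r : ℝ | ∃ τ : ℝ, σ ^ 2 < τ ∧ r = ψ (τ / σ) / ψ τ}

/-- A function whose increments over short intervals are `o` of those of a fixed function `V`
takes the same value at both endpoints. -/
theorem eq_of_small_increments {D V : ℝ → ℝ} {a b : ℝ} (hab : a ≤ b)
    (h : ∀ ε > 0, ∃ δ > 0, ∀ x y, a ≤ x → x ≤ y → y ≤ b → y - x < δ →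
      |D y - D x| ≤ ε * (V y - V x)) : D b = D a := by
  have key : ∀ ε > 0, |D b - D a| ≤ ε * (V b - V a) := by
    intro ε hε
    obtain ⟨δ, hδ, hD⟩ := h ε hε
    obtain ⟨n, hn⟩ := exists_nat_gt ((b - a) / δ)
    have hn0 : (0 : ℝ) < n := lt_of_le_of_lt (div_nonneg (sub_nonneg.2 hab) hδ.le) hn
    set d := (b - a) / n with hd
    have hd0 : 0 ≤ d := div_nonneg (sub_nonneg.2 hab) hn0.le
    have hdδ : d < δ := by
      rw [hd, div_lt_iff₀ hn0]
      rwa [div_lt_iff₀ hδ, mul_comm] at hn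
    have hnd : n * d = b - a := by rw [hd]; field_simp
    have step : ∀ i : ℕ, i ≤ n →
        |D (a + i * d) - D a| ≤ ε * (V (a + i * d) - V a) := by
      intro i
      induction i with
      | zero => intro _; simp
      | succ i ih =>
        intro hi
        have h1 := ih (by omega)
        have hi' : ((i : ℝ) + 1) * d ≤ n * d :=
          mul_le_mul_of_nonneg_right (by exact_mod_cast hi) hd0
        have h2 := hD (a + i * d) (a + ((i + 1 : ℕ) : ℝ) * d)
          (by have : 0 ≤ (i : ℝ) * d := by positivity
              linarith)
          (by push_cast; linarith) (by push_cast; linarith) (by push_cast; linarith)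
        have h3 := abs_sub_le (D (a + ((i + 1 : ℕ) : ℝ) * d)) (D (a + i * d)) (D a)
        linarith
    have := step n le_rfl
    rwa [hnd, add_sub_cancel] at this
  by_contra hne
  have hpos : 0 < |D b - D a| := abs_pos.2 (sub_ne_zero.2 hne)
  have hW : 0 < V b - V a := by
    have := key 1 one_pos
    linarith
  have := key (|D b - D a| / (2 * (V b - V a))) (by positivity)
  have h2 : |D b - D a| / (2 * (V b - V a)) * (V b - V a) = |D b - D a| / 2 := by
    field_simp
  linarith

theorem exists_delta_of_continuousOn_Icc {f : ℝ → ℝ} {a b : ℝ} (hf : ContinuousOn f (Icc a b))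
    {ε : ℝ} (hε : 0 < ε) : ∃ δ > 0, ∀ x ∈ Icc a b, ∀ y ∈ Icc a b, |y - x| < δ →
      |f y - f x| ≤ ε := by
  have hu := isCompact_Icc.uniformContinuousOn_of_continuous hf
  rw [Metric.uniformContinuousOn_iff] at hu
  obtain ⟨δ, hδ, h⟩ := hu ε hε
  exact ⟨δ, hδ, fun x hx y hy hxy => (h y hy x hx hxy).le⟩

namespace IsLogStieltjes

variable {μ : Measure ℝ} {ρ : ℝ → ℝ}

theorem real_Ioc (hμ : IsLogStieltjes μ ρ) (hρ : Monotone ρ) {a b : ℝ} (ha : 0 < a)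
    (hab : a ≤ b) : μ.real (Ioc a b) = ρ (log b) - ρ (log a) := by
  rw [Measure.real, hμ a b ha hab,
    ENNReal.toReal_ofReal (sub_nonneg.2 (hρ (log_le_log ha hab)))]

theorem Ioc_lt_top (hμ : IsLogStieltjes μ ρ) {a : ℝ} (ha : 0 < a) (b : ℝ) :
    μ (Ioc a b) < ⊤ := by
  rcases le_or_gt a b with hab | hab
  · rw [hμ a b ha hab]; exact ENNReal.ofReal_lt_top
  · simp [Ioc_eq_empty_of_le hab.le]

theorem integrableOn_Ioc (hμ : IsLogStieltjes μ ρ) {f : ℝ → ℝ} {a b : ℝ} (ha : 0 < a)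
    (hf : ContinuousOn f (Icc a b)) : IntegrableOn f (Ioc a b) μ := by
  obtain ⟨C, hC⟩ := isCompact_Icc.exists_bound_of_continuousOn hf
  exact IntegrableOn.of_bound (hμ.Ioc_lt_top ha b)
    ((hf.mono Ioc_subset_Icc_self).aestronglyMeasurable measurableSet_Ioc) C
    ((ae_restrict_iff' measurableSet_Ioc).2
      (ae_of_all _ fun x hx => hC x (Ioc_subset_Icc_self hx)))

/-- If `f` is within `ε` of `c` on `(a, b]`, its integral is within `ε μ (a, b]` of `c μ (a, b]`. -/
theorem abs_setIntegral_sub_le (hμ : IsLogStieltjes μ ρ) (hρ : Monotone ρ) {f : ℝ → ℝ}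
    {a b c ε : ℝ} (ha : 0 < a) (hab : a ≤ b) (hf : ContinuousOn f (Icc a b))
    (h : ∀ x ∈ Icc a b, |f x - c| ≤ ε) :
    |(∫ x in Ioc a b, f x ∂μ) - c * (ρ (log b) - ρ (log a))| ≤
      ε * (ρ (log b) - ρ (log a)) := by
  have hfin := hμ.Ioc_lt_top ha b
  have h1 : ∫ x in Ioc a b, (f x - c) ∂μ =
      (∫ x in Ioc a b, f x ∂μ) - c * (ρ (log b) - ρ (log a)) := by
    rw [integral_sub (hμ.integrableOn_Ioc ha hf) (integrableOn_const hfin.ne),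
      setIntegral_const, hμ.real_Ioc hρ ha hab, smul_eq_mul, mul_comm c]
  rw [← h1, ← hμ.real_Ioc hρ ha hab, ← Real.norm_eq_abs]
  exact norm_setIntegral_le_of_norm_le_const hfin fun x hx => h x (Ioc_subset_Icc_self hx)

theorem setIntegral_add (hμ : IsLogStieltjes μ ρ) {f : ℝ → ℝ} {a b c : ℝ} (ha : 0 < a)
    (hab : a ≤ b) (hbc : b ≤ c) (hf : ContinuousOn f (Icc a c)) :
    ∫ x in Ioc a c, f x ∂μ = (∫ x in Ioc a b, f x ∂μ) + ∫ x in Ioc b c, f x ∂μ := by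
  rw [← Ioc_union_Ioc_eq_Ioc hab hbc]
  exact setIntegral_union (Ioc_disjoint_Ioc_of_le le_rfl) measurableSet_Ioc
    (hμ.integrableOn_Ioc ha (hf.mono (Icc_subset_Icc_right hbc)))
    (hμ.integrableOn_Ioc (ha.trans_le hab) (hf.mono (Icc_subset_Icc_left hab)))

/-- Integration by parts for the product `k(σ) ρ(ln σ) ρt(ln(τ/σ))`, the increments of the last
factor being transported by `σ ↦ τ/σ`. -/
theorem integral_by_parts {μt : Measure ℝ} {ρt k k' : ℝ → ℝ} (hμ : IsLogStieltjes μ ρ)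
    (hμt : IsLogStieltjes μt ρt) (hρ : Monotone ρ) (hρt : Monotone ρt) (hρc : Continuous ρ)
    (hρtc : Continuous ρt) {a b τ : ℝ} (ha : 0 < a) (hab : a ≤ b) (hτ : 0 < τ)
    (hk : ∀ x ∈ Icc a b, HasDerivAt k (k' x) x) (hk' : ContinuousOn k' (Icc a b)) :
    (∫ σ in Ioc (τ / b) (τ / a), k (τ / σ) * ρ (log (τ / σ)) ∂μt) -
        ∫ σ in Ioc a b, k σ * ρt (log (τ / σ)) ∂μ =
      k a * (ρ (log a) * ρt (log (τ / a))) - k b * (ρ (log b) * ρt (log (τ / b))) +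
        ∫ σ in a..b, k' σ * (ρ (log σ) * ρt (log (τ / σ))) := by
  have hpos : ∀ x ∈ Icc a b, x ≠ 0 := fun x hx => (ha.trans_le hx.1).ne'
  have hkc : ContinuousOn k (Icc a b) := fun x hx => (hk x hx).continuousAt.continuousWithinAt
  have hr : ContinuousOn (fun σ => ρ (log σ)) (Icc a b) :=
    hρc.comp_continuousOn (continuousOn_id.log hpos)
  have hq : ContinuousOn (fun σ => ρt (log (τ / σ))) (Icc a b) :=
    hρtc.comp_continuousOn ((continuousOn_const.div continuousOn_id hpos).log
      fun x hx => div_ne_zero hτ.ne' (hpos x hx))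
  set w : ℝ → ℝ := fun σ => ρ (log σ) * ρt (log (τ / σ)) with hw
  have hwc : ContinuousOn w (Icc a b) := hr.mul hq
  set F : ℝ → ℝ := fun σ => k σ * ρ (log σ) with hF
  set G : ℝ → ℝ := fun σ => k σ * ρt (log (τ / σ)) with hG
  have hFc : ContinuousOn F (Icc a b) := hkc.mul hr
  have hGc : ContinuousOn G (Icc a b) := hkc.mul hq
  have hmaps : ∀ x y, a ≤ x → y ≤ b → 0 < y → ∀ σ ∈ Icc (τ / y) (τ / x), τ / σ ∈ Icc x y := by
    intro x y hx hy hy0 σ hσ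
    have hσ0 : 0 < σ := (div_pos hτ hy0).trans_le hσ.1
    have hx0 := ha.trans_le hx
    constructor
    · rw [le_div_iff₀ hσ0]; have := (le_div_iff₀ hx0).1 hσ.2; linarith
    · rw [div_le_iff₀ hσ0]; have := (div_le_iff₀ hy0).1 hσ.1; linarith
  have hdiv : ∀ x y, a ≤ x → y ≤ b → 0 < y →
      ContinuousOn (fun σ => F (τ / σ)) (Icc (τ / y) (τ / x)) := by
    intro x y hx hy hy0
    refine hFc.comp (continuousOn_const.div continuousOn_id fun σ hσ =>
      ((div_pos hτ hy0).trans_le hσ.1).ne') fun σ hσ => ?_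
    exact Icc_subset_Icc hx hy (hmaps x y hx hy hy0 σ hσ)
  obtain ⟨C₁, hC₁⟩ := isCompact_Icc.exists_bound_of_continuousOn hkc
  obtain ⟨C₂, hC₂⟩ := isCompact_Icc.exists_bound_of_continuousOn hk'
  have hC₁0 : 0 ≤ C₁ := (norm_nonneg _).trans (hC₁ a ⟨le_rfl, hab⟩)
  have hC₂0 : 0 ≤ C₂ := (norm_nonneg _).trans (hC₂ a ⟨le_rfl, hab⟩)
  have hintv : ∀ x y, a ≤ x → x ≤ y → y ≤ b → ∀ f : ℝ → ℝ, ContinuousOn f (Icc a b) →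
      IntervalIntegrable f volume x y := by
    intro x y hx hxy hy f hf
    exact (hf.mono (by rw [uIcc_of_le hxy]; exact Icc_subset_Icc hx hy)).intervalIntegrable
  set D : ℝ → ℝ := fun y => (∫ σ in Ioc (τ / y) (τ / a), F (τ / σ) ∂μt) -
    (∫ σ in Ioc a y, G σ ∂μ) + k y * w y - ∫ σ in a..y, k' σ * w σ with hD
  set V : ℝ → ℝ := fun y => -(1 + C₁) * ρt (log (τ / y)) + ρ (log y) + C₂ * y with hV
  have hDab : D b = D a := by
    refine eq_of_small_increments (V := V) hab fun ε hε => ?_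
    obtain ⟨δ₁, hδ₁, h₁⟩ := exists_delta_of_continuousOn_Icc hFc hε
    obtain ⟨δ₂, hδ₂, h₂⟩ := exists_delta_of_continuousOn_Icc hGc hε
    obtain ⟨δ₃, hδ₃, h₃⟩ := exists_delta_of_continuousOn_Icc hwc hε
    obtain ⟨δ₄, hδ₄, h₄⟩ := exists_delta_of_continuousOn_Icc hr hε
    refine ⟨min (min δ₁ δ₂) (min δ₃ δ₄), by positivity, fun x y hx hxy hy hlt => ?_⟩
    simp only [lt_min_iff] at hlt
    obtain ⟨⟨hl₁, hl₂⟩, hl₃, hl₄⟩ := hlt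
    have hx0 : 0 < x := ha.trans_le hx
    have hy0 : 0 < y := hx0.trans_le hxy
    have hxm : x ∈ Icc a b := ⟨hx, hxy.trans hy⟩
    have hym : y ∈ Icc a b := ⟨hx.trans hxy, hy⟩
    have hsub : Icc x y ⊆ Icc a b := Icc_subset_Icc hx hy
    have hτyx : τ / y ≤ τ / x := div_le_div_of_nonneg_left hτ.le hx0 hxy
    have hτxa : τ / x ≤ τ / a := div_le_div_of_nonneg_left hτ.le ha hx
    have hτy : 0 < τ / y := div_pos hτ hy0
    have habs : ∀ δ, y - x < δ → ∀ σ ∈ Icc x y, |σ - x| < δ := fun δ hδ σ hσ => by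
      rw [abs_of_nonneg (sub_nonneg.2 hσ.1)]; linarith [hσ.2]
    have e1 := hμt.abs_setIntegral_sub_le hρt (f := fun σ => F (τ / σ)) (c := F x) (ε := ε)
      hτy hτyx (hdiv x y hx hy hy0) fun σ hσ => by
        have := hmaps x y hx hy hy0 σ hσ
        exact h₁ x hxm _ (hsub this) (habs _ hl₁ _ this)
    have e2 := hμ.abs_setIntegral_sub_le hρ (f := G) (c := G x) (ε := ε)
      hx0 hxy (hGc.mono hsub) fun σ hσ => h₂ x hxm σ (hsub hσ) (habs _ hl₂ _ hσ)
    have e3 : |(k y - k x) * w y - ∫ σ in x..y, k' σ * w σ| ≤ C₂ * ε * (y - x) := by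
      have hkk : ∫ σ in x..y, k' σ = k y - k x :=
        intervalIntegral.integral_eq_sub_of_hasDerivAt
          (fun σ hσ => hk σ (hsub (by rwa [uIcc_of_le hxy] at hσ)))
          (hintv x y hx hxy hy _ hk')
      have : (k y - k x) * w y - ∫ σ in x..y, k' σ * w σ =
          ∫ σ in x..y, k' σ * (w y - w σ) := by
        rw [← hkk, ← intervalIntegral.integral_mul_const, ← intervalIntegral.integral_sub
          (hintv x y hx hxy hy (fun σ => k' σ * w y) (hk'.mul continuousOn_const))
          (hintv x y hx hxy hy (fun σ => k' σ * w σ) (hk'.mul hwc))]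
        simp only [mul_sub]
      rw [this]
      have hle := intervalIntegral.norm_integral_le_of_norm_le_const (a := x) (b := y)
        (f := fun σ => k' σ * (w y - w σ)) (C := C₂ * ε) fun σ hσ => by
          rw [uIoc_of_le hxy] at hσ
          have hσ' := Ioc_subset_Icc_self hσ
          rw [norm_mul]
          refine mul_le_mul (hC₂ σ (hsub hσ')) (h₃ σ (hsub hσ') y hym ?_) (norm_nonneg _) hC₂0
          rw [abs_of_nonneg (sub_nonneg.2 hσ'.2)]; linarith [hσ'.1]
      rwa [Real.norm_eq_abs, abs_of_nonneg (sub_nonneg.2 hxy)] at hle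
    have e4 : |k x * ((ρ (log y) - ρ (log x)) * (ρt (log (τ / y)) - ρt (log (τ / x))))| ≤
        C₁ * (ε * (ρt (log (τ / x)) - ρt (log (τ / y)))) := by
      rw [abs_mul, abs_mul, abs_sub_comm (ρt _)]
      have hq0 : 0 ≤ ρt (log (τ / x)) - ρt (log (τ / y)) :=
        sub_nonneg.2 (hρt (log_le_log hτy hτyx))
      rw [abs_of_nonneg hq0]
      refine mul_le_mul (hC₁ x hxm) (mul_le_mul_of_nonneg_right ?_ hq0) (by positivity) hC₁0
      exact h₄ x hxm y hym (habs _ hl₄ y ⟨hxy, le_rfl⟩)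
    have s1 := hμt.setIntegral_add hτy hτyx hτxa (f := fun σ => F (τ / σ))
      (hdiv a y le_rfl hy hy0)
    have s2 := hμ.setIntegral_add ha hx hxy (f := G) (hGc.mono (Icc_subset_Icc_right hy))
    have s3 := intervalIntegral.integral_add_adjacent_intervals
      (hintv a x le_rfl hx (hxy.trans hy) (fun σ => k' σ * w σ) (hk'.mul hwc))
      (hintv x y hx hxy hy (fun σ => k' σ * w σ) (hk'.mul hwc))
    simp only [hD, hV]
    rw [s1, s2, ← s3]
    simp only [hw, hF, hG] at e1 e2 e3 e4 ⊢
    rw [abs_le] at *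
    constructor <;> linarith [e1.1, e1.2, e2.1, e2.2, e3.1, e3.2, e4.1, e4.2]
  simp only [hD, Ioc_self, setIntegral_empty, intervalIntegral.integral_same] at hDab
  linarith

end IsLogStieltjes

/-- A function with vanishing logarithmic derivative is comparable to its multiplicative translates,
uniformly on bounded ranges. -/
theorem eventually_comparable_translates {φ : ℝ → ℝ} (hpos : ∀ x > 0, 0 < φ x)
    (hd : Differentiable ℝ φ)
    (hlim : Tendsto (fun τ => τ * deriv φ τ / φ τ) atTop (nhds 0)) {A : ℝ} (hA : 1 ≤ A) :
    ∀ᶠ τ in atTop, ∀ σ ∈ Icc 1 A, φ τ / 2 ≤ φ (τ / σ) ∧ φ (τ / σ) ≤ 2 * φ τ := by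
  have hA0 : 0 < A := by linarith
  have hl2 : 0 < log 2 := log_pos one_lt_two
  obtain ⟨X, hX⟩ := eventually_atTop.1
    (hlim.eventually (Metric.ball_mem_nhds 0 (div_pos hl2 hA0)))
  filter_upwards [eventually_ge_atTop (max X 1 * A)] with τ hτ σ hσ
  have hX1 : 0 < max X 1 := lt_max_of_lt_right one_pos
  have hσ0 : 0 < σ := by linarith [hσ.1]
  have hτ0 : 0 < τ := (mul_pos hX1 hA0).trans_le hτ
  have hlow : max X 1 ≤ τ / A := (le_div_iff₀ hA0).2 hτ
  have hmem : τ / σ ∈ Icc (τ / A) τ :=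
    ⟨div_le_div_of_nonneg_left hτ0.le hσ0 hσ.2, div_le_self hτ0.le hσ.1⟩
  have hmem' : τ ∈ Icc (τ / A) τ := ⟨div_le_self hτ0.le hA, le_rfl⟩
  have hu0 : ∀ u ∈ Icc (τ / A) τ, 0 < u := fun u hu => hX1.trans_le (hlow.trans hu.1)
  have hmv := (convex_Icc (τ / A) τ).norm_image_sub_le_of_norm_hasDerivWithin_le
    (f := fun u => log (φ u)) (f' := fun u => deriv φ u / φ u) (C := log 2 / τ)
    (fun u hu => ((hd u).hasDerivAt.log (hpos u (hu0 u hu)).ne').hasDerivWithinAt)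
    (fun u hu => by
      have h0 := hu0 u hu
      have h1 := hX u ((le_max_left _ _).trans (hlow.trans hu.1))
      rw [dist_zero_right, mul_div_assoc, norm_mul, Real.norm_of_nonneg h0.le] at h1
      have h2 : τ / A * ‖deriv φ u / φ u‖ ≤ log 2 / A :=
        (mul_le_mul_of_nonneg_right hu.1 (norm_nonneg _)).trans h1.le
      rw [le_div_iff₀ hτ0]
      have h3 : τ / A * ‖deriv φ u / φ u‖ * A ≤ log 2 / A * A :=
        mul_le_mul_of_nonneg_right h2 hA0.le
      rw [div_mul_cancel₀ _ hA0.ne'] at h3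
      have h4 : τ / A * ‖deriv φ u / φ u‖ * A = ‖deriv φ u / φ u‖ * τ := by field_simp
      linarith)
    hmem' hmem
  have hP := hpos (τ / σ) (hu0 _ hmem)
  have hQ := hpos τ hτ0
  have hle : |log (φ (τ / σ)) - log (φ τ)| ≤ log 2 := by
    rw [← Real.norm_eq_abs]
    refine hmv.trans ?_
    have : ‖τ / σ - τ‖ ≤ τ := by
      have := (div_pos hτ0 hσ0).le
      rw [Real.norm_eq_abs, abs_le]; constructor <;> linarith [hmem.2]
    calc log 2 / τ * ‖τ / σ - τ‖ ≤ log 2 / τ * τ := by gcongr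
      _ = log 2 := by field_simp
  rw [abs_le] at hle
  constructor
  · rw [← log_le_log_iff (by positivity) hP, log_div hQ.ne' two_ne_zero]; linarith
  · rw [← log_le_log_iff hP (by positivity), log_mul two_ne_zero hQ.ne']; linarith

theorem exists_le_integral_of_not_integrableOn {f : ℝ → ℝ} {a : ℝ} (hf : ContinuousOn f (Ici a))
    (h0 : ∀ x ≥ a, 0 ≤ f x) (hdiv : ¬ IntegrableOn f (Ici a)) (N : ℝ) :
    ∃ b ≥ a, N ≤ ∫ x in a..b, f x := by
  by_contra! hcon
  refine hdiv ((integrableOn_Ici_iff_integrableOn_Ioi).2 ?_)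
  refine integrableOn_Ioi_of_intervalIntegral_norm_bounded N a (b := id) (l := atTop)
    (fun b => ?_) tendsto_id ?_
  · exact ((hf.mono Icc_subset_Ici_self).integrableOn_Icc).mono_set Ioc_subset_Icc_self
  · filter_upwards [eventually_ge_atTop a] with b hb
    have : ∫ x in a..b, ‖f x‖ = ∫ x in a..b, f x := by
      refine intervalIntegral.integral_congr fun x hx => ?_
      rw [uIcc_of_le hb] at hx
      exact Real.norm_of_nonneg (h0 x hx.1)
    exact (this.trans_lt (hcon b hb)).le

/-- The logarithmic weight `∫_1^{√τ} φ(σ) ψ(τ/σ) dσ/σ` in interval-integral form. -/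
def mellinWeight (φ ψ : ℝ → ℝ) (τ : ℝ) : ℝ := ∫ σ in (1 : ℝ)..√τ, φ σ * ψ (τ / σ) / σ

/-- The derivative of `σ ↦ φ(σ) ψ(τ/σ)`. -/
def kernelDeriv (φ ψ : ℝ → ℝ) (τ σ : ℝ) : ℝ :=
  deriv φ σ * ψ (τ / σ) + φ σ * (deriv ψ (τ / σ) * (-τ / σ ^ 2))

section Kernel

variable {φ ψ : ℝ → ℝ}

theorem hasDerivAt_kernel (hφ : Differentiable ℝ φ) (hψ : Differentiable ℝ ψ) (τ : ℝ) {σ : ℝ}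
    (hσ : σ ≠ 0) : HasDerivAt (fun σ => φ σ * ψ (τ / σ)) (kernelDeriv φ ψ τ σ) σ := by
  have h1 : HasDerivAt (fun σ : ℝ => τ / σ) (-τ / σ ^ 2) σ := by
    have := (hasDerivAt_const σ τ).fun_div (hasDerivAt_id σ) hσ
    simpa using this
  exact (hφ σ).hasDerivAt.mul ((hψ (τ / σ)).hasDerivAt.comp σ h1)

theorem continuousOn_const_div_Icc (τ : ℝ) {a b : ℝ} (ha : 0 < a) :
    ContinuousOn (fun σ : ℝ => τ / σ) (Icc a b) :=
  continuousOn_const.div continuousOn_id fun _ hσ => (ha.trans_le hσ.1).ne'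

theorem continuousOn_kernel (hφ : Continuous φ) (hψ : Continuous ψ) (τ : ℝ) {a b : ℝ}
    (ha : 0 < a) : ContinuousOn (fun σ => φ σ * ψ (τ / σ)) (Icc a b) :=
  hφ.continuousOn.mul (hψ.comp_continuousOn (continuousOn_const_div_Icc τ ha))

theorem continuousOn_kernel_div (hφ : Continuous φ) (hψ : Continuous ψ) (τ : ℝ) {a b : ℝ}
    (ha : 0 < a) : ContinuousOn (fun σ => φ σ * ψ (τ / σ) / σ) (Icc a b) :=
  (continuousOn_kernel hφ hψ τ ha).div continuousOn_id fun _ hσ => (ha.trans_le hσ.1).ne'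

theorem continuousOn_kernelDeriv (hφ : ContDiff ℝ 1 φ) (hψ : ContDiff ℝ 1 ψ) (τ : ℝ) {a b : ℝ}
    (ha : 0 < a) : ContinuousOn (kernelDeriv φ ψ τ) (Icc a b) := by
  have hd := continuousOn_const_div_Icc τ (b := b) ha
  refine (((hφ.continuous_deriv le_rfl).continuousOn).mul
    (hψ.continuous.comp_continuousOn hd)).add (hφ.continuous.continuousOn.mul
      (((hψ.continuous_deriv le_rfl).comp_continuousOn hd).mul
        (continuousOn_const.div (continuousOn_id.pow 2) fun σ hσ => ?_)))
  exact pow_ne_zero _ (ha.trans_le hσ.1).ne'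

theorem intervalIntegrable_of_continuousOn_Icc {f : ℝ → ℝ} {a b : ℝ} (hab : a ≤ b)
    (hf : ContinuousOn f (Icc a b)) : IntervalIntegrable f volume a b :=
  (hf.mono (by rw [uIcc_of_le hab])).intervalIntegrable

theorem eventually_const_mul_le_mellinWeight (hφ0 : ∀ x > 0, 0 < φ x) (hψ0 : ∀ x > 0, 0 < ψ x)
    (hφ : Continuous φ) (hψ : ContDiff ℝ 1 ψ)
    (hψ1 : Tendsto (fun τ => τ * deriv ψ τ / ψ τ) atTop (nhds 0))
    (hdiv : ¬ IntegrableOn (fun τ => φ τ / τ) (Ici 1)) (N : ℝ) :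
    ∀ᶠ τ in atTop, N * ψ τ ≤ mellinWeight φ ψ τ := by
  have hc : ContinuousOn (fun τ => φ τ / τ) (Ici 1) :=
    hφ.continuousOn.div continuousOn_id fun x hx => (one_pos.trans_le hx).ne'
  obtain ⟨B, hB, hN⟩ := exists_le_integral_of_not_integrableOn hc
    (fun x hx => (div_pos (hφ0 x (by linarith)) (by linarith)).le) hdiv (2 * N)
  filter_upwards [eventually_comparable_translates hψ0 (hψ.differentiable one_ne_zero) hψ1 hB,
    tendsto_sqrt_atTop.eventually_ge_atTop B, eventually_gt_atTop 0] with τ hτ hBτ hτ0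
  have h1 : ∫ σ in (1 : ℝ)..B, ψ τ / 2 * (φ σ / σ) ≤ ∫ σ in (1 : ℝ)..B, φ σ * ψ (τ / σ) / σ := by
    refine intervalIntegral.integral_mono_on hB
      (intervalIntegrable_of_continuousOn_Icc hB
        (continuousOn_const.mul (hc.mono Icc_subset_Ici_self)))
      (intervalIntegrable_of_continuousOn_Icc hB
        (continuousOn_kernel_div hφ hψ.continuous τ one_pos)) fun σ hσ => ?_
    have hσ0 : 0 < σ := one_pos.trans_le hσ.1
    have := mul_le_mul_of_nonneg_right (hτ σ hσ).1 (div_pos (hφ0 σ hσ0) hσ0).le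
    calc _ ≤ _ := this
      _ = _ := by ring
  have h2 : ∫ σ in (1 : ℝ)..B, φ σ * ψ (τ / σ) / σ ≤ mellinWeight φ ψ τ := by
    have hK := fun {a b : ℝ} (ha : 0 < a) (hab : a ≤ b) =>
      intervalIntegrable_of_continuousOn_Icc hab
        (continuousOn_kernel_div hφ hψ.continuous τ ha)
    rw [mellinWeight, ← intervalIntegral.integral_add_adjacent_intervals (hK one_pos hB)
      (hK (one_pos.trans_le hB) hBτ)]
    refine le_add_of_nonneg_right (intervalIntegral.integral_nonneg hBτ fun σ hσ => ?_)
    have hσ0 : 0 < σ := (one_pos.trans_le hB).trans_le hσ.1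
    exact (div_pos (mul_pos (hφ0 σ hσ0) (hψ0 _ (div_pos hτ0 hσ0))) hσ0).le
  rw [intervalIntegral.integral_const_mul] at h1
  have h3 := mul_le_mul_of_nonneg_left hN (half_pos (hψ0 τ hτ0)).le
  linarith

/-- Bound of the derivative of the kernel by the logarithmic derivatives of the two factors. -/
theorem abs_kernelDeriv_le (hφ0 : ∀ x > 0, 0 < φ x) (hψ0 : ∀ x > 0, 0 < ψ x) {τ σ ε : ℝ}
    (hτ : 0 < τ) (hσ : 0 < σ) (hψε : |τ / σ * deriv ψ (τ / σ) / ψ (τ / σ)| ≤ ε) :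
    |kernelDeriv φ ψ τ σ| ≤
      |σ * deriv φ σ / φ σ| * (φ σ * ψ (τ / σ) / σ) + ε * (φ σ * ψ (τ / σ) / σ) := by
  have hP := hφ0 σ hσ
  have hQ := hψ0 _ (div_pos hτ hσ)
  have hk : 0 < φ σ * ψ (τ / σ) / σ := by positivity
  have : kernelDeriv φ ψ τ σ = σ * deriv φ σ / φ σ * (φ σ * ψ (τ / σ) / σ) +
      -(τ / σ * deriv ψ (τ / σ) / ψ (τ / σ)) * (φ σ * ψ (τ / σ) / σ) := by
    rw [kernelDeriv]; field_simp
  rw [this]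
  refine (abs_add_le _ _).trans ?_
  rw [abs_mul, abs_mul, abs_neg, abs_of_pos hk]
  gcongr

theorem eventually_integral_kernelDeriv_le (hφ0 : ∀ x > 0, 0 < φ x) (hψ0 : ∀ x > 0, 0 < ψ x)
    (hφ : ContDiff ℝ 1 φ) (hψ : ContDiff ℝ 1 ψ)
    (hφ1 : Tendsto (fun τ => τ * deriv φ τ / φ τ) atTop (nhds 0))
    (hψ1 : Tendsto (fun τ => τ * deriv ψ τ / ψ τ) atTop (nhds 0))
    (hdiv : ¬ IntegrableOn (fun τ => φ τ / τ) (Ici 1)) {ε : ℝ} (hε : 0 < ε) :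
    ∀ᶠ τ in atTop, ∫ σ in (1 : ℝ)..√τ, |kernelDeriv φ ψ τ σ| ≤ ε * mellinWeight φ ψ τ := by
  have hsmall : ∀ {f : ℝ → ℝ}, Tendsto f atTop (nhds 0) → ∃ X, ∀ x ≥ X, |f x| ≤ ε / 4 := by
    intro f hf
    obtain ⟨X, hX⟩ := eventually_atTop.1
      (hf.eventually (Metric.ball_mem_nhds 0 (show 0 < ε / 4 by positivity)))
    exact ⟨X, fun x hx => by simpa using (hX x hx).le⟩
  obtain ⟨A₀, hA₀⟩ := hsmall hφ1
  obtain ⟨X, hX⟩ := hsmall hψ1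
  set A := max A₀ 1 with hA
  have hA1 : 1 ≤ A := le_max_right _ _
  have hA0 : 0 < A := one_pos.trans_le hA1
  obtain ⟨C, hC⟩ := isCompact_Icc.exists_bound_of_continuousOn (s := Icc 1 A)
    (hφ.continuous_deriv le_rfl).continuousOn
  have hC0 : 0 ≤ C := (norm_nonneg _).trans (hC 1 ⟨le_rfl, hA1⟩)
  filter_upwards [eventually_comparable_translates hψ0 (hψ.differentiable one_ne_zero) hψ1 hA1,
    tendsto_sqrt_atTop.eventually_ge_atTop A, tendsto_sqrt_atTop.eventually_ge_atTop X,
    eventually_gt_atTop 0,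
    eventually_const_mul_le_mellinWeight hφ0 hψ0 hφ.continuous hψ hψ1 hdiv (4 * C * A / ε)]
    with τ hτ hAτ hXτ hτ0 hN
  have hQ := hψ0 τ hτ0
  have hbig : ∀ σ, 0 < σ → σ ≤ √τ → X ≤ τ / σ := fun σ hσ hle => by
    refine hXτ.trans ((le_div_iff₀ hσ).2 ?_)
    calc √τ * σ ≤ √τ * √τ := by gcongr
      _ = τ := mul_self_sqrt hτ0.le
  have hK := fun {a b : ℝ} (ha : 0 < a) (hab : a ≤ b) =>
    intervalIntegrable_of_continuousOn_Icc hab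
      (continuousOn_kernel_div hφ.continuous hψ.continuous τ ha)
  have hD := fun {a b : ℝ} (ha : 0 < a) (hab : a ≤ b) =>
    intervalIntegrable_of_continuousOn_Icc hab (continuousOn_kernelDeriv hφ hψ τ ha).abs
  have hkpos : ∀ σ, 0 < σ → 0 < φ σ * ψ (τ / σ) / σ := fun σ hσ =>
    div_pos (mul_pos (hφ0 σ hσ) (hψ0 _ (div_pos hτ0 hσ))) hσ
  have h1 : ∫ σ in (1 : ℝ)..A, |kernelDeriv φ ψ τ σ| ≤
      ∫ σ in (1 : ℝ)..A, (C * (2 * ψ τ) + ε / 2 * (φ σ * ψ (τ / σ) / σ)) := by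
    refine intervalIntegral.integral_mono_on hA1 (hD one_pos hA1)
      (intervalIntegrable_const.add ((hK one_pos hA1).const_mul _)) fun σ hσ => ?_
    have hσ0 : 0 < σ := one_pos.trans_le hσ.1
    refine (abs_kernelDeriv_le hφ0 hψ0 hτ0 hσ0 (hX _ (hbig σ hσ0 (hσ.2.trans hAτ)))).trans ?_
    have hP := hφ0 σ hσ0
    have e1 : |σ * deriv φ σ / φ σ| * (φ σ * ψ (τ / σ) / σ) = |deriv φ σ| * ψ (τ / σ) := by
      rw [abs_div, abs_mul, abs_of_pos hσ0, abs_of_pos hP]; field_simp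
    have e2 : |deriv φ σ| * ψ (τ / σ) ≤ C * (2 * ψ τ) :=
      mul_le_mul (hC σ hσ) (hτ σ hσ).2 (hψ0 _ (div_pos hτ0 hσ0)).le hC0
    rw [e1]
    nlinarith [hkpos σ hσ0]
  have h2 : ∫ σ in A..√τ, |kernelDeriv φ ψ τ σ| ≤
      ∫ σ in A..√τ, ε / 2 * (φ σ * ψ (τ / σ) / σ) := by
    refine intervalIntegral.integral_mono_on hAτ (hD hA0 hAτ)
      ((hK hA0 hAτ).const_mul _) fun σ hσ => ?_
    have hσ0 : 0 < σ := hA0.trans_le hσ.1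
    refine (abs_kernelDeriv_le hφ0 hψ0 hτ0 hσ0 (hX _ (hbig σ hσ0 hσ.2))).trans ?_
    have := mul_le_mul_of_nonneg_right (hA₀ σ ((le_max_left _ _).trans hσ.1)) (hkpos σ hσ0).le
    linarith
  rw [intervalIntegral.integral_add intervalIntegrable_const ((hK one_pos hA1).const_mul _),
    intervalIntegral.integral_const, intervalIntegral.integral_const_mul, smul_eq_mul] at h1
  rw [intervalIntegral.integral_const_mul] at h2
  have hsumD := intervalIntegral.integral_add_adjacent_intervals (hD one_pos hA1) (hD hA0 hAτ)
  have hsumK := intervalIntegral.integral_add_adjacent_intervals (hK one_pos hA1) (hK hA0 hAτ)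
  have hN' := mul_le_mul_of_nonneg_left hN (half_pos hε).le
  have e3 : ε / 2 * (4 * C * A / ε * ψ τ) = 2 * C * A * ψ τ := by field_simp; ring
  rw [e3] at hN'
  have e4 : 0 ≤ C * ψ τ := by positivity
  rw [← hsumD]
  change _ ≤ ε * ∫ σ in (1 : ℝ)..√τ, φ σ * ψ (τ / σ) / σ
  change _ ≤ ε / 2 * ∫ σ in (1 : ℝ)..√τ, φ σ * ψ (τ / σ) / σ at hN'
  rw [← hsumK] at hN' ⊢
  nlinarith

end Kernel

section Comparison

variable {p : ℝ} {φ φt s st ρ ρt : ℝ → ℝ} {μ μt : Measure ℝ}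

theorem continuous_of_eq_exp_mul (hs : Continuous s)
    (hsform : ∀ τ, s τ = exp (-τ / p) * ρ τ) : Continuous ρ := by
  have : ρ = fun τ => exp (τ / p) * s τ := by
    funext τ
    rw [hsform, ← mul_assoc, ← exp_add, ← add_div, add_neg_cancel, zero_div, exp_zero, one_mul]
  rw [this]
  fun_prop

theorem div_eq_exp (hs0 : ∀ τ, 0 < s τ) (hsform : ∀ τ, s τ = exp (-τ / p) * ρ τ) (x : ℝ) :
    s x / ρ x = exp (-x / p) := by
  have h : ρ x ≠ 0 := by
    rintro h0
    have := hs0 x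
    rw [hsform, h0, mul_zero] at this
    exact this.false
  rw [hsform, mul_div_cancel_right₀ _ h]

theorem exp_mul_mul_eq (hsform : ∀ τ, s τ = exp (-τ / p) * ρ τ)
    (hstform : ∀ τ, st τ = exp (-τ / p) * ρt τ) {τ σ : ℝ} (hτ : 0 < τ) (hσ : 0 < σ) :
    exp (-log τ / p) * (ρ (log σ) * ρt (log (τ / σ))) = s (log σ) * st (log (τ / σ)) := by
  have : exp (-log τ / p) = exp (-log σ / p) * exp (-log (τ / σ) / p) := by
    rw [← exp_add, log_div hτ.ne' hσ.ne']; congr 1; ring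
  rw [this, hsform, hstform]; ring

/-- With `s/ρ` and the prefactor of `st` made explicit, `H` becomes a Stieltjes integral of
`φ(σ) φt(τ/σ) ρt(ln(τ/σ))`. -/
theorem almostH_eq (hs0 : ∀ τ, 0 < s τ) (hsform : ∀ τ, s τ = exp (-τ / p) * ρ τ)
    (hstform : ∀ τ, st τ = exp (-τ / p) * ρt τ) {τ : ℝ} (hτ : 0 < τ) :
    almostH φt φ st s ρ μ τ = exp (-log τ / p) *
      ∫ σ in Ioc 1 √τ, φ σ * φt (τ / σ) * ρt (log (τ / σ)) ∂μ := by
  rw [almostH, almostMellinOn, ← integral_const_mul]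
  refine setIntegral_congr_fun measurableSet_Ioc fun σ hσ => ?_
  have hσ0 : 0 < σ := one_pos.trans hσ.1
  have h1 := div_eq_exp hs0 hsform (log σ)
  have h2 : exp (-log τ / p) = exp (-log σ / p) * exp (-log (τ / σ) / p) := by
    rw [← exp_add, log_div hτ.ne' hσ0.ne']; congr 1; ring
  simp only [mul_div_assoc, h1, hstform, h2]
  ring

theorem almostH1_eq (hst0 : ∀ τ, 0 < st τ) (hsform : ∀ τ, s τ = exp (-τ / p) * ρ τ)
    (hstform : ∀ τ, st τ = exp (-τ / p) * ρt τ) {τ : ℝ} (hτ : 0 < τ) :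
    almostH1 φ φt s st ρt μt τ = exp (-log τ / p) *
      ∫ σ in Ioc √τ τ, φ (τ / σ) * φt (τ / (τ / σ)) * ρ (log (τ / σ)) ∂μt := by
  rw [almostH1, almostMellinOn, ← integral_const_mul]
  refine setIntegral_congr_fun measurableSet_Ioc fun σ hσ => ?_
  have hσ0 : 0 < σ := (sqrt_nonneg τ).trans_lt hσ.1
  have h1 := div_eq_exp hst0 hstform (log σ)
  have h2 : exp (-log τ / p) = exp (-log σ / p) * exp (-log (τ / σ) / p) := by
    rw [← exp_add, log_div hτ.ne' hσ0.ne']; congr 1; ring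
  simp only [mul_div_assoc, h1, hsform, h2, div_div_cancel₀ hτ.ne']
  ring

/-- The kernel at the right endpoint is controlled by the left endpoint and its variation. -/
theorem kernel_sqrt_le (hφ : ContDiff ℝ 1 φ) (hφt : ContDiff ℝ 1 φt) {τ : ℝ} (hτ : 1 ≤ √τ) :
    φ √τ * φt (τ / √τ) ≤
      φ 1 * φt (τ / 1) + ∫ σ in (1 : ℝ)..√τ, |kernelDeriv φ φt τ σ| := by
  have hD := continuousOn_kernelDeriv hφ hφt τ (b := √τ) one_pos
  have h1 := intervalIntegral.integral_eq_sub_of_hasDerivAt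
    (f := fun σ => φ σ * φt (τ / σ)) (f' := kernelDeriv φ φt τ) (a := 1) (b := √τ)
    (fun σ hσ => by
      rw [uIcc_of_le hτ] at hσ
      exact hasDerivAt_kernel (hφ.differentiable one_ne_zero) (hφt.differentiable one_ne_zero) τ
        (one_pos.trans_le hσ.1).ne')
    (intervalIntegrable_of_continuousOn_Icc hτ hD)
  have h2 := intervalIntegral.integral_mono_on hτ (intervalIntegrable_of_continuousOn_Icc hτ hD)
    (intervalIntegrable_of_continuousOn_Icc hτ hD.abs) fun σ _ => le_abs_self _
  linarith

theorem abs_almostH1_sub_almostH_le (hφ0 : ∀ x > 0, 0 < φ x) (hφt0 : ∀ x > 0, 0 < φt x)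
    (hφ : ContDiff ℝ 1 φ) (hφt : ContDiff ℝ 1 φt) (hs : Continuous s) (hst : Continuous st)
    (hs0 : ∀ τ, 0 < s τ) (hst0 : ∀ τ, 0 < st τ) {M Mt : ℝ} (hM : ∀ τ, s τ ≤ M)
    (hMt : ∀ τ, st τ ≤ Mt) (hρ : Monotone ρ) (hρt : Monotone ρt)
    (hsform : ∀ τ, s τ = exp (-τ / p) * ρ τ) (hstform : ∀ τ, st τ = exp (-τ / p) * ρt τ)
    (hμ : IsLogStieltjes μ ρ) (hμt : IsLogStieltjes μt ρt) {τ : ℝ} (hτ : 0 < τ)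
    (hτ1 : 1 ≤ √τ) :
    |almostH1 φ φt s st ρt μt τ - almostH φt φ st s ρ μ τ| ≤
      M * Mt * (2 * (φ 1 * φt τ) + 2 * ∫ σ in (1 : ℝ)..√τ, |kernelDeriv φ φt τ σ|) := by
  have hD := continuousOn_kernelDeriv hφ hφt τ (b := √τ) one_pos
  have hparts := hμ.integral_by_parts hμt hρ hρt (continuous_of_eq_exp_mul hs hsform)
    (continuous_of_eq_exp_mul hst hstform) one_pos hτ1 hτ
    (fun σ hσ => hasDerivAt_kernel (hφ.differentiable one_ne_zero)
      (hφt.differentiable one_ne_zero) τ (one_pos.trans_le hσ.1).ne') hD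
  rw [div_sqrt, div_one] at hparts
  rw [almostH1_eq hst0 hsform hstform hτ, almostH_eq hs0 hsform hstform hτ, ← mul_sub, hparts,
    mul_add, mul_sub, mul_left_comm (exp _) (φ 1 * φt τ), mul_left_comm (exp _) (φ √τ * φt √τ),
    ← intervalIntegral.integral_const_mul]
  have hv : ∀ σ, |s (log σ) * st (log (τ / σ))| ≤ M * Mt := fun σ => by
    rw [abs_of_pos (mul_pos (hs0 _) (hst0 _))]
    exact mul_le_mul (hM _) (hMt _) (hst0 _).le ((hs0 0).le.trans (hM 0))
  have hv1 := exp_mul_mul_eq hsform hstform hτ one_pos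
  have hv2 := exp_mul_mul_eq hsform hstform hτ (one_pos.trans_le hτ1)
  rw [div_one] at hv1
  rw [div_sqrt] at hv2
  rw [hv1, hv2]
  have hw1 := hv 1
  have hw2 := hv √τ
  rw [div_one] at hw1
  rw [div_sqrt] at hw2
  have hk1 : 0 < φ 1 * φt τ := mul_pos (hφ0 1 one_pos) (hφt0 τ hτ)
  have hk2 : 0 < φ √τ * φt √τ :=
    mul_pos (hφ0 _ (one_pos.trans_le hτ1)) (hφt0 _ (one_pos.trans_le hτ1))
  have hintv : |∫ σ in (1 : ℝ)..√τ, exp (-log τ / p) *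
      (kernelDeriv φ φt τ σ * (ρ (log σ) * ρt (log (τ / σ))))| ≤
      M * Mt * ∫ σ in (1 : ℝ)..√τ, |kernelDeriv φ φt τ σ| := by
    rw [← intervalIntegral.integral_const_mul, ← Real.norm_eq_abs]
    refine intervalIntegral.norm_integral_le_of_norm_le hτ1 (ae_of_all _ fun σ hσ => ?_)
      (intervalIntegrable_of_continuousOn_Icc hτ1 (continuousOn_const.mul hD.abs))
    rw [mul_left_comm, exp_mul_mul_eq hsform hstform hτ (one_pos.trans hσ.1), norm_mul, mul_comm]
    exact mul_le_mul_of_nonneg_right (hv σ) (abs_nonneg _)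
  have hkb := kernel_sqrt_le hφ hφt hτ1
  rw [div_sqrt, div_one] at hkb
  have hC : 0 ≤ M * Mt := (abs_nonneg _).trans (hv 1)
  have b1 : |φ 1 * φt τ * (s (log 1) * st (log τ))| ≤ φ 1 * φt τ * (M * Mt) := by
    rw [abs_mul, abs_of_pos hk1]; exact mul_le_mul_of_nonneg_left hw1 hk1.le
  have b2 : |φ √τ * φt √τ * (s (log √τ) * st (log √τ))| ≤ φ √τ * φt √τ * (M * Mt) := by
    rw [abs_mul, abs_of_pos hk2]; exact mul_le_mul_of_nonneg_left hw2 hk2.le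
  have b3 := mul_le_mul_of_nonneg_right hkb hC
  refine (abs_add_le _ _).trans ?_
  have b4 := abs_sub (φ 1 * φt τ * (s (log 1) * st (log τ)))
    (φ √τ * φt √τ * (s (log √τ) * st (log √τ)))
  linarith

theorem le_almostH (hp : 0 < p) (hφ0 : ∀ x > 0, 0 < φ x) (hφt0 : ∀ x > 0, 0 < φt x)
    (hφ : ContDiff ℝ 1 φ) (hφt : ContDiff ℝ 1 φt) (hs : Continuous s) (hst : Continuous st)
    {m M mt : ℝ} (hm0 : 0 < m) (hmt0 : 0 < mt) (hm : ∀ τ, m ≤ s τ) (hM : ∀ τ, s τ ≤ M)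
    (hmt : ∀ τ, mt ≤ st τ) (hρ : Monotone ρ) (hsform : ∀ τ, s τ = exp (-τ / p) * ρ τ)
    (hμ : IsLogStieltjes μ ρ) {τ : ℝ} (hτ : 0 < τ) (hτ1 : 1 ≤ √τ) :
    mt * (m / p * mellinWeight φ φt τ - M * (φ 1 * φt τ) -
      M * ∫ σ in (1 : ℝ)..√τ, |kernelDeriv φ φt τ σ|) ≤ almostH φt φ st s ρ μ τ := by
  have hs0 : ∀ τ, 0 < s τ := fun τ => hm0.trans_le (hm τ)
  have hD := continuousOn_kernelDeriv hφ hφt τ (b := √τ) one_pos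
  have hK := continuousOn_kernel hφ.continuous hφt.continuous τ (b := √τ) one_pos
  have hKd := continuousOn_kernel_div hφ.continuous hφt.continuous τ (b := √τ) one_pos
  have hne : ∀ σ ∈ Icc (1 : ℝ) √τ, σ ≠ 0 := fun σ hσ => (one_pos.trans_le hσ.1).ne'
  have hlog : ContinuousOn log (Icc 1 √τ) := continuousOn_log.mono fun σ hσ => hne σ hσ
  have he : ContinuousOn (fun σ => exp (-log σ / p)) (Icc 1 √τ) := (hlog.neg.div_const p).rexp
  set k : ℝ → ℝ := fun σ => φ σ * φt (τ / σ) * exp (-log σ / p) with hk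
  have hderiv : ∀ σ ∈ Icc (1 : ℝ) √τ, HasDerivAt k
      (kernelDeriv φ φt τ σ * exp (-log σ / p) +
        φ σ * φt (τ / σ) * (exp (-log σ / p) * (-σ⁻¹ / p))) σ := fun σ hσ =>
    (hasDerivAt_kernel (hφ.differentiable one_ne_zero) (hφt.differentiable one_ne_zero) τ
      (hne σ hσ)).mul (((hasDerivAt_log (hne σ hσ)).neg.div_const p).exp)
  have h0 : IsLogStieltjes (0 : Measure ℝ) fun _ => 1 := fun a b _ _ => by simp
  have hparts := hμ.integral_by_parts h0 hρ monotone_const (continuous_of_eq_exp_mul hs hsform)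
    continuous_const one_pos hτ1 hτ hderiv
    ((hD.mul he).add (hK.mul (he.mul ((continuousOn_id.inv₀ hne).neg.div_const p))))
  simp only [Measure.restrict_zero, integral_zero_measure, mul_one, zero_sub] at hparts
  have hsl : ContinuousOn (fun σ => s (log σ)) (Icc 1 √τ) := hs.comp_continuousOn hlog
  have hi1 : IntervalIntegrable (fun σ => kernelDeriv φ φt τ σ * s (log σ)) volume 1 √τ :=
    intervalIntegrable_of_continuousOn_Icc hτ1 (hD.mul hsl)
  have hi2 : IntervalIntegrable (fun σ => φ σ * φt (τ / σ) / σ * s (log σ)) volume 1 √τ :=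
    intervalIntegrable_of_continuousOn_Icc hτ1 (hKd.mul hsl)
  have hI : ∫ σ in (1 : ℝ)..√τ, (kernelDeriv φ φt τ σ * exp (-log σ / p) +
        φ σ * φt (τ / σ) * (exp (-log σ / p) * (-σ⁻¹ / p))) * ρ (log σ) =
      (∫ σ in (1 : ℝ)..√τ, kernelDeriv φ φt τ σ * s (log σ)) -
        1 / p * ∫ σ in (1 : ℝ)..√τ, φ σ * φt (τ / σ) / σ * s (log σ) := by
    rw [← intervalIntegral.integral_const_mul,
      ← intervalIntegral.integral_sub hi1 (hi2.const_mul _)]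
    refine intervalIntegral.integral_congr fun σ _ => ?_
    simp only [hsform]
    ring
  have hsk : ∀ σ, k σ * ρ (log σ) = φ σ * φt (τ / σ) * s (log σ) := fun σ => by
    simp only [hk, hsform]; ring
  rw [hI, hsk, hsk, div_one, div_sqrt] at hparts
  have hkpos : ∀ σ > 0, 0 < φ σ * φt (τ / σ) := fun σ hσ =>
    mul_pos (hφ0 σ hσ) (hφt0 _ (div_pos hτ hσ))
  have b1 : φ 1 * φt τ * s (log 1) ≤ M * (φ 1 * φt τ) := by
    rw [mul_comm]
    exact mul_le_mul_of_nonneg_right (hM _) (mul_pos (hφ0 1 one_pos) (hφt0 τ hτ)).le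
  have hsq : 0 < √τ := one_pos.trans_le hτ1
  have b2 : 0 ≤ φ √τ * φt √τ * s (log √τ) :=
    (mul_pos (mul_pos (hφ0 _ hsq) (hφt0 _ hsq)) (hs0 _)).le
  have b3 : ∫ σ in (1 : ℝ)..√τ, kernelDeriv φ φt τ σ * s (log σ) ≤
      M * ∫ σ in (1 : ℝ)..√τ, |kernelDeriv φ φt τ σ| := by
    rw [← intervalIntegral.integral_const_mul]
    refine intervalIntegral.integral_mono_on hτ1 hi1
      ((intervalIntegrable_of_continuousOn_Icc hτ1 hD.abs).const_mul _) fun σ _ => ?_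
    calc kernelDeriv φ φt τ σ * s (log σ) ≤ |kernelDeriv φ φt τ σ| * s (log σ) :=
          mul_le_mul_of_nonneg_right (le_abs_self _) (hs0 _).le
      _ ≤ |kernelDeriv φ φt τ σ| * M := mul_le_mul_of_nonneg_left (hM _) (abs_nonneg _)
      _ = _ := mul_comm _ _
  have b4 : m * mellinWeight φ φt τ ≤
      ∫ σ in (1 : ℝ)..√τ, φ σ * φt (τ / σ) / σ * s (log σ) := by
    rw [mellinWeight, ← intervalIntegral.integral_const_mul]
    refine intervalIntegral.integral_mono_on hτ1
      ((intervalIntegrable_of_continuousOn_Icc hτ1 hKd).const_mul _) hi2 fun σ hσ => ?_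
    have hσ0 : 0 < σ := one_pos.trans_le hσ.1
    rw [mul_comm]
    exact mul_le_mul_of_nonneg_left (hm _) (div_pos (hkpos σ hσ0) hσ0).le
  have b5 := mul_le_mul_of_nonneg_left b4 (one_div_pos.2 hp).le
  have hkint : m / p * mellinWeight φ φt τ - M * (φ 1 * φt τ) -
      M * ∫ σ in (1 : ℝ)..√τ, |kernelDeriv φ φt τ σ| ≤ ∫ σ in Ioc 1 √τ, k σ ∂μ := by
    have : m / p * mellinWeight φ φt τ = 1 / p * (m * mellinWeight φ φt τ) := by ring
    linarith
  refine (mul_le_mul_of_nonneg_left hkint hmt0.le).trans ?_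
  have hkc : ContinuousOn k (Icc 1 √τ) := hK.mul he
  rw [← integral_const_mul]
  have hstl : ContinuousOn (fun σ => st (log (τ / σ))) (Icc 1 √τ) :=
    hst.comp_continuousOn ((continuousOn_const_div_Icc τ one_pos).log
      fun σ hσ => div_ne_zero hτ.ne' (hne σ hσ))
  have hH : almostH φt φ st s ρ μ τ = ∫ σ in Ioc 1 √τ, st (log (τ / σ)) * k σ ∂μ := by
    rw [almostH, almostMellinOn]
    refine setIntegral_congr_fun measurableSet_Ioc fun σ _ => ?_
    simp only [mul_div_assoc, div_eq_exp hs0 hsform (log σ), hk]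
    ring
  rw [hH]
  refine setIntegral_mono_on (hμ.integrableOn_Ioc one_pos (continuousOn_const.mul hkc))
    (hμ.integrableOn_Ioc one_pos (hstl.mul hkc)) measurableSet_Ioc fun σ hσ => ?_
  exact mul_le_mul_of_nonneg_right (hmt _)
    (mul_pos (hkpos σ (one_pos.trans hσ.1)) (exp_pos _)).le

theorem almostH1_isEquivalent_almostH (hp : 0 < p) (hφ0 : ∀ x > 0, 0 < φ x)
    (hφt0 : ∀ x > 0, 0 < φt x) (hφ : ContDiff ℝ 1 φ) (hφt : ContDiff ℝ 1 φt)
    (hφ1 : Tendsto (fun τ => τ * deriv φ τ / φ τ) atTop (nhds 0))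
    (hφt1 : Tendsto (fun τ => τ * deriv φt τ / φt τ) atTop (nhds 0))
    (hs : Continuous s) (hst : Continuous st)
    (hsb : ∃ m M : ℝ, 0 < m ∧ ∀ τ, m ≤ s τ ∧ s τ ≤ M)
    (hstb : ∃ m M : ℝ, 0 < m ∧ ∀ τ, m ≤ st τ ∧ st τ ≤ M)
    (hρ : Monotone ρ) (hρt : Monotone ρt)
    (hsform : ∀ τ, s τ = exp (-τ / p) * ρ τ) (hstform : ∀ τ, st τ = exp (-τ / p) * ρt τ)
    (hμ : IsLogStieltjes μ ρ) (hμt : IsLogStieltjes μt ρt)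
    (hdiv : ¬ IntegrableOn (fun τ => φ τ / τ) (Ici 1)) :
    almostH1 φ φt s st ρt μt ~[atTop] almostH φt φ st s ρ μ := by
  obtain ⟨m, M, hm0, hsb⟩ := hsb
  obtain ⟨mt, Mt, hmt0, hstb⟩ := hstb
  have hM0 : 0 < M := hm0.trans_le ((hsb 0).1.trans (hsb 0).2)
  have hMt0 : 0 < Mt := hmt0.trans_le ((hstb 0).1.trans (hstb 0).2)
  rw [IsEquivalent, isLittleO_iff]
  intro c hc
  set η := min (m / (4 * M * p)) (c * mt * m / (8 * M * Mt * p)) with hη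
  have hη0 : 0 < η := by positivity
  have hη1 : η * (4 * M * p) ≤ m := (le_div_iff₀ (by positivity)).1 (min_le_left _ _)
  have hη2 : η * (8 * M * Mt * p) ≤ c * mt * m :=
    (le_div_iff₀ (by positivity)).1 (min_le_right _ _)
  filter_upwards [eventually_gt_atTop 0, tendsto_sqrt_atTop.eventually_ge_atTop 1,
    eventually_const_mul_le_mellinWeight hφ0 hφt0 hφ.continuous hφt hφt1 hdiv (φ 1 / η),
    eventually_integral_kernelDeriv_le hφ0 hφt0 hφ hφt hφ1 hφt1 hdiv hη0] with τ hτ hτ1 hN hE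
  have hup := abs_almostH1_sub_almostH_le hφ0 hφt0 hφ hφt hs hst
    (fun τ => hm0.trans_le (hsb τ).1) (fun τ => hmt0.trans_le (hstb τ).1) (fun τ => (hsb τ).2)
    (fun τ => (hstb τ).2) hρ hρt hsform hstform hμ hμt hτ hτ1
  have hlow := le_almostH hp hφ0 hφt0 hφ hφt hs hst hm0 hmt0 (fun τ => (hsb τ).1)
    (fun τ => (hsb τ).2) (fun τ => (hstb τ).1) hρ hsform hμ hτ hτ1
  have hk1 : φ 1 * φt τ ≤ η * mellinWeight φ φt τ := by
    rwa [div_mul_eq_mul_div, div_le_iff₀ hη0, mul_comm _ η] at hN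
  have hK0 : 0 ≤ mellinWeight φ φt τ := by
    have : 0 < η * mellinWeight φ φt τ :=
      (mul_pos (hφ0 1 one_pos) (hφt0 τ hτ)).trans_le hk1
    exact (pos_of_mul_pos_right this hη0.le).le
  set K := mellinWeight φ φt τ
  have hlow' : mt * (m / (2 * p)) * K ≤ almostH φt φ st s ρ μ τ := by
    refine le_trans ?_ hlow
    rw [mul_assoc]
    refine mul_le_mul_of_nonneg_left ?_ hmt0.le
    have h1 : 2 * M * η ≤ m / (2 * p) := (le_div_iff₀ (by positivity)).2 (by linarith)
    have h2 := mul_le_mul_of_nonneg_right h1 hK0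
    have h3 := mul_le_mul_of_nonneg_left hk1 hM0.le
    have h4 := mul_le_mul_of_nonneg_left hE hM0.le
    have h5 : m / p * K = m / (2 * p) * K + m / (2 * p) * K := by field_simp; ring
    linarith
  have hup' : M * Mt * (2 * (φ 1 * φt τ) + 2 * ∫ σ in (1 : ℝ)..√τ, |kernelDeriv φ φt τ σ|) ≤
      c * (mt * (m / (2 * p)) * K) := by
    have h1 : 4 * M * Mt * η ≤ c * mt * (m / (2 * p)) := by
      rw [← mul_div_assoc]; exact (le_div_iff₀ (by positivity)).2 (by linarith)
    have h2 := mul_le_mul_of_nonneg_right h1 hK0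
    have h3 := mul_le_mul_of_nonneg_left (add_le_add hk1 hE) (mul_pos hM0 hMt0).le
    linarith
  refine hup.trans (hup'.trans ?_)
  exact mul_le_mul_of_nonneg_left (hlow'.trans (le_abs_self _)) hc.le

/-- The almost Mellin integrand is positive, so its integrals are nonnegative. -/
theorem almostMellinOn_nonneg (hφ0 : ∀ x > 0, 0 < φ x) (hφt0 : ∀ x > 0, 0 < φt x)
    (hs0 : ∀ τ, 0 < s τ) (hst0 : ∀ τ, 0 < st τ)
    (hstform : ∀ τ, st τ = exp (-τ / p) * ρt τ) {a b τ : ℝ} (ha : 0 ≤ a) (hτ : 0 < τ) :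
    0 ≤ almostMellinOn (Ioc a b) φ φt s st ρt μt τ := by
  refine setIntegral_nonneg measurableSet_Ioc fun σ hσ => ?_
  have hσ0 : 0 < σ := ha.trans_lt hσ.1
  rw [mul_div_assoc, div_eq_exp hst0 hstform]
  have h1 := hφ0 _ (div_pos hτ hσ0)
  have h2 := hφt0 _ hσ0
  have h3 := hs0 (log (τ / σ))
  positivity

theorem almostMellin_eq_add (hφ : Continuous φ) (hφt : Continuous φt) (hs : Continuous s)
    (hst : Continuous st) (hst0 : ∀ τ, 0 < st τ)
    (hstform : ∀ τ, st τ = exp (-τ / p) * ρt τ) (hμt : IsLogStieltjes μt ρt) {τ : ℝ}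
    (hτ : 1 ≤ τ) :
    almostMellin φ φt s st ρt μt τ = almostH φ φt s st ρt μt τ + almostH1 φ φt s st ρt μt τ := by
  have hτ0 : 0 < τ := one_pos.trans_le hτ
  have hne : ∀ σ ∈ Icc (1 : ℝ) τ, σ ≠ 0 := fun σ hσ => (one_pos.trans_le hσ.1).ne'
  have hd := continuousOn_const_div_Icc τ (b := τ) one_pos
  have hlog : ContinuousOn log (Icc 1 τ) := continuousOn_log.mono fun σ hσ => hne σ hσ
  have hρt0 : ∀ x, ρt x ≠ 0 := fun x h => by
    have := hst0 x
    rw [hstform, h, mul_zero] at this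
    exact this.false
  exact hμt.setIntegral_add one_pos (one_le_sqrt.2 hτ) (sqrt_le_iff.2 ⟨hτ0.le, by nlinarith⟩)
    (((((hφ.comp_continuousOn hd).mul hφt.continuousOn).mul
      (hs.comp_continuousOn (hd.log fun σ hσ => div_ne_zero hτ0.ne' (hne σ hσ)))).mul
      (hst.comp_continuousOn hlog)).div
      ((continuous_of_eq_exp_mul hst hstform).comp_continuousOn hlog) fun σ _ => hρt0 _)

end Comparison

/-- asymptotic symmetry of the almost Mellin convolution when both SVF
integrals diverge: `H₁[φs, φ̃s̃](τ) = H[φ̃s̃, φs](τ)(1 + o(1))` and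
`(φs ∗ φ̃s̃)(τ) = (φ̃s̃ ∗ φs)(τ)(1 + o(1))` as `τ → ∞`.  The SVFs are assumed
`C²`-smooth with `τ(ln φ)'(τ) → 0` and `τ²(ln φ)''(τ) → 0`. -/
theorem stmt3 (p T Tt : ℝ) (hp : 0 < p) (hT : 0 < T) (hTt : 0 < Tt)
    (φ φt s st ρ ρt : ℝ → ℝ) (μ μt : MeasureTheory.Measure ℝ)
    (hφ : IsSVF φ) (hφt : IsSVF φt)
    (hφC : ContDiff ℝ 2 φ) (hφtC : ContDiff ℝ 2 φt)
    (hφ1 : Tendsto (fun τ => τ * deriv φ τ / φ τ) atTop (nhds 0))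
    (hφ2 : Tendsto (fun τ => τ ^ 2 * deriv (fun x => deriv φ x / φ x) τ) atTop (nhds 0))
    (hφt1 : Tendsto (fun τ => τ * deriv φt τ / φt τ) atTop (nhds 0))
    (hφt2 : Tendsto (fun τ => τ ^ 2 * deriv (fun x => deriv φt x / φt x) τ) atTop (nhds 0))
    (hs : Continuous s) (hst : Continuous st)
    (hsper : Function.Periodic s T) (hstper : Function.Periodic st Tt)
    (hsb : ∃ m M : ℝ, 0 < m ∧ ∀ τ, m ≤ s τ ∧ s τ ≤ M)
    (hstb : ∃ m M : ℝ, 0 < m ∧ ∀ τ, m ≤ st τ ∧ st τ ≤ M)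
    (hρ : Monotone ρ) (hρt : Monotone ρt)
    (hsform : ∀ τ, s τ = Real.exp (-τ / p) * ρ τ)
    (hstform : ∀ τ, st τ = Real.exp (-τ / p) * ρt τ)
    (hμ : IsLogStieltjes μ ρ) (hμt : IsLogStieltjes μt ρt)
    (hdivφ : ¬ MeasureTheory.IntegrableOn (fun τ => φ τ / τ) (Set.Ici 1)
      MeasureTheory.volume)
    (hdivφt : ¬ MeasureTheory.IntegrableOn (fun τ => φt τ / τ) (Set.Ici 1)
      MeasureTheory.volume) :
    (almostH1 φ φt s st ρt μt ~[atTop] almostH φt φ st s ρ μ) ∧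
    (almostMellin φ φt s st ρt μt ~[atTop] almostMellin φt φ st s ρ μ) := by
  have hφ' : ContDiff ℝ 1 φ := hφC.of_le one_le_two
  have hφt' : ContDiff ℝ 1 φt := hφtC.of_le one_le_two
  have hs0 : ∀ τ, 0 < s τ := by
    obtain ⟨m, _, hm, h⟩ := hsb
    exact fun τ => hm.trans_le (h τ).1
  have hst0 : ∀ τ, 0 < st τ := by
    obtain ⟨m, _, hm, h⟩ := hstb
    exact fun τ => hm.trans_le (h τ).1
  have h1 : almostH1 φ φt s st ρt μt ~[atTop] almostH φt φ st s ρ μ :=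
    almostH1_isEquivalent_almostH hp hφ.1 hφt.1 hφ' hφt' hφ1 hφt1 hs hst hsb hstb hρ hρt
      hsform hstform hμ hμt hdivφ
  have h2 : almostH1 φt φ st s ρ μ ~[atTop] almostH φ φt s st ρt μt :=
    almostH1_isEquivalent_almostH hp hφt.1 hφ.1 hφt' hφ' hφt1 hφ1 hst hs hstb hsb hρt hρ
      hstform hsform hμt hμ hdivφt
  refine ⟨h1, ?_⟩
  have e1 : almostMellin φ φt s st ρt μt =ᶠ[atTop]
      fun τ => almostH1 φ φt s st ρt μt τ + almostH φ φt s st ρt μt τ := by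
    filter_upwards [eventually_ge_atTop 1] with τ hτ
    rw [almostMellin_eq_add hφ'.continuous hφt'.continuous hs hst hst0 hstform hμt hτ, add_comm]
  have e2 : almostMellin φt φ st s ρ μ =ᶠ[atTop]
      fun τ => almostH φt φ st s ρ μ τ + almostH1 φt φ st s ρ μ τ := by
    filter_upwards [eventually_ge_atTop 1] with τ hτ
    exact almostMellin_eq_add hφt'.continuous hφ'.continuous hst hs hs0 hsform hμ hτ
  refine IsEquivalent.congr_left (IsEquivalent.congr_right ?_ e2.symm) e1.symm
  rw [IsEquivalent, isLittleO_iff]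
  intro c hc
  filter_upwards [isLittleO_iff.1 h1.isLittleO hc, isLittleO_iff.1 h2.symm.isLittleO hc,
    eventually_gt_atTop 0] with τ hH hH1 hτ
  have n1 : 0 ≤ almostH φt φ st s ρ μ τ :=
    almostMellinOn_nonneg hφt.1 hφ.1 hst0 hs0 hsform zero_le_one hτ
  have n2 : 0 ≤ almostH1 φt φ st s ρ μ τ :=
    almostMellinOn_nonneg hφt.1 hφ.1 hst0 hs0 hsform (sqrt_nonneg τ) hτ
  simp only [Pi.sub_apply, Real.norm_eq_abs] at hH hH1 ⊢
  rw [abs_of_nonneg n1] at hH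
  rw [abs_of_nonneg n2] at hH1
  rw [abs_of_nonneg (add_nonneg n1 n2), add_sub_add_comm]
  exact (abs_add_le _ _).trans (by linarith)
end
end

section
/- Assume ∫_1^∞ φ̃(τ) dτ/τ = ∞ and that s and s̃ have a common period T. Then ∫_1^{√τ} φ(τ/σ) s(ln(τ/σ)) φ̃(σ) s̃(ln σ) dσ/σ ~ h_{φ̃,φ}(τ)·(s ⋆ s̃)(ln τ) as τ → ∞. If, in addition, ∫_1^∞ φ(τ) dτ/τ = ∞, then ∫_1^τ φ(τ/σ) s(ln(τ/σ)) φ̃(σ) s̃(ln σ) dσ/σ ~ (φ∗φ̃)(τ)·(s ⋆ s̃)(ln τ) as τ → ∞. -/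
open MeasureTheory Filter Real Set Asymptotics

noncomputable section

/-- A function `l` is additively slowly varying when `l (x + u) - l x → 0` at infinity for each
fixed shift `u`; no regularity is assumed. -/
def AddSlowVar (l : ℝ → ℝ) : Prop :=
  ∀ u : ℝ, Tendsto (fun x => l (x + u) - l x) atTop (nhds 0)

/-- On windows at bounded distance from `a n → ∞`, the set where `l` differs noticeably from
`l (a n)` has small measure. -/
theorem AddSlowVar.tendsto_measure_window {l : ℝ → ℝ} (hl : AddSlowVar l) {a w : ℕ → ℝ}
    (ha : Tendsto a atTop atTop) {R L : ℝ} (hR : ∀ n, |a n - w n| ≤ R)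
    (hm : ∀ n, AEMeasurable l (volume.restrict (Ioc (w n) (w n + L)))) {ε : ℝ} (hε : 0 < ε) :
    Tendsto (fun n => volume {y | y ∈ Ioc (w n) (w n + L) ∧ ε ≤ |l y - l (a n)|})
      atTop (nhds 0) := by
  set D : ℕ → ℝ → ℝ := fun n => ((fun z => a n + z) ⁻¹' Ioc (w n) (w n + L)).indicator
    (fun z => l (a n + z) - l (a n)) with hD
  have hmeas : ∀ n, AEStronglyMeasurable (D n) (volume.restrict (Icc (-R) (R + L))) := by
    intro n
    have h1 : AEMeasurable (fun z => l (a n + z))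
        (volume.restrict ((fun z => a n + z) ⁻¹' Ioc (w n) (w n + L))) :=
      (hm n).comp_quasiMeasurePreserving
        ((measurePreserving_add_left volume (a n)).restrict_preimage
          measurableSet_Ioc).quasiMeasurePreserving
    have h2 : AEMeasurable (D n) volume :=
      (aemeasurable_indicator_iff (measurableSet_Ioc.preimage (measurable_const_add (a n)))).2
        (h1.sub_const _)
    exact (h2.mono_measure Measure.restrict_le_self).aestronglyMeasurable
  have hlim : ∀ z, Tendsto (fun n => D n z) atTop (nhds 0) := by
    intro z
    refine squeeze_zero_norm (a := fun n => |l (a n + z) - l (a n)|) (fun n => ?_) ?_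
    · exact norm_indicator_le_norm_self (fun z => l (a n + z) - l (a n)) z
    · simpa using ((hl z).comp ha).abs
  have key := tendstoInMeasure_of_tendsto_ae (g := fun _ => (0 : ℝ)) hmeas
    (Eventually.of_forall hlim) (ENNReal.ofReal ε) (by simpa using hε)
  refine tendsto_of_tendsto_of_tendsto_of_le_of_le tendsto_const_nhds key
    (fun n => bot_le) (fun n => ?_)
  rw [Measure.restrict_apply₀' measurableSet_Icc.nullMeasurableSet]
  show volume _ ≤ volume _
  rw [← measure_preimage_add volume (a n)]
  refine measure_mono fun z hz => ?_
  obtain ⟨hz1, hz2⟩ := hz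
  have hRn := abs_le.1 (hR n)
  refine ⟨?_, ?_⟩
  · have : D n z = l (a n + z) - l (a n) := 
      indicator_of_mem (s := (fun z => a n + z) ⁻¹' Ioc (w n) (w n + L)) hz1
        (fun z => l (a n + z) - l (a n))
    show ENNReal.ofReal ε ≤ edist (D n z) 0
    rw [this]
    rw [edist_dist, Real.dist_eq, sub_zero]
    exact ENNReal.ofReal_le_ofReal hz2
  · constructor <;> linarith [hz1.1, hz1.2]

/-- Uniform convergence theorem for slowly varying functions, along sequences and with
measurability only required on windows of fixed length near the points compared. -/
theorem AddSlowVar.tendsto_sub {l : ℝ → ℝ} (hl : AddSlowVar l) {a b w : ℕ → ℝ}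
    (ha : Tendsto a atTop atTop) (hb : Tendsto b atTop atTop) {R L : ℝ} (hL : 0 < L)
    (hRa : ∀ n, |a n - w n| ≤ R) (hRb : ∀ n, |b n - w n| ≤ R)
    (hm : ∀ n, AEMeasurable l (volume.restrict (Ioc (w n) (w n + L)))) :
    Tendsto (fun n => l (a n) - l (b n)) atTop (nhds 0) := by
  rw [Metric.tendsto_nhds]
  intro ε hε
  have hL' : (0 : ENNReal) < ENNReal.ofReal (L / 2) := by simpa using hL
  filter_upwards [(hl.tendsto_measure_window ha hRa hm (half_pos hε)).eventually_lt_const hL',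
    (hl.tendsto_measure_window hb hRb hm (half_pos hε)).eventually_lt_const hL'] with n h1 h2
  obtain ⟨y, hy, hya, hyb⟩ : ∃ y ∈ Ioc (w n) (w n + L),
      |l y - l (a n)| < ε / 2 ∧ |l y - l (b n)| < ε / 2 := by
    by_contra! hcon
    have hsub : Ioc (w n) (w n + L) ⊆ {y | y ∈ Ioc (w n) (w n + L) ∧ ε / 2 ≤ |l y - l (a n)|} ∪
        {y | y ∈ Ioc (w n) (w n + L) ∧ ε / 2 ≤ |l y - l (b n)|} := by
      intro y hy
      by_cases h : |l y - l (a n)| < ε / 2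
      · exact Or.inr ⟨hy, hcon y hy h⟩
      · exact Or.inl ⟨hy, not_lt.1 h⟩
    have h3 := (measure_mono hsub).trans (measure_union_le (μ := volume) _ _)
    have h4 := h3.trans_lt (ENNReal.add_lt_add h1 h2)
    rw [Real.volume_Ioc, ← ENNReal.ofReal_add (by positivity) (by positivity)] at h4
    norm_num at h4
  rw [Real.dist_eq, sub_zero]
  rw [abs_lt] at *
  constructor <;> linarith

theorem AddSlowVar.exists_forall_abs_sub_le {l : ℝ → ℝ} (hl : AddSlowVar l)
    (hm : ∀ A, AEMeasurable l (volume.restrict (Ioc 0 A))) (T : ℝ) {δ : ℝ} (hδ : 0 < δ) :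
    ∃ X, 0 ≤ X ∧ ∀ x, X ≤ x → ∀ u ∈ Icc 0 T, |l (x + u) - l x| ≤ δ := by
  by_contra! hcon
  choose x hx u hu hxu using fun n : ℕ => hcon n n.cast_nonneg
  have hx' : Tendsto x atTop atTop := tendsto_atTop_mono hx tendsto_natCast_atTop_atTop
  have hxu' : Tendsto (fun n => x n + u n) atTop atTop :=
    tendsto_atTop_mono (fun n => by linarith [(hu n).1]) hx'
  have key := hl.tendsto_sub (w := x) (R := T) (L := 1) hxu' hx' one_pos
    (fun n => by rw [add_sub_cancel_left, abs_of_nonneg (hu n).1]; exact (hu n).2)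
    (fun n => by simpa using (hu n).1.trans (hu n).2)
    (fun n => (hm (x n + 1)).mono_set
      (Ioc_subset_Ioc_left ((Nat.cast_nonneg n).trans (hx n))))
  have := key.abs.eventually_lt_const (by simpa using hδ)
  obtain ⟨n, hn⟩ := this.exists
  exact absurd hn (not_lt.2 (hxu n).le)

theorem AddSlowVar.eventually_forall_abs_sub_le {l : ℝ → ℝ} (hl : AddSlowVar l) {t : ℕ → ℝ}
    (ht : Tendsto t atTop atTop)
    (hm : ∀ n, AEMeasurable l (volume.restrict (Ico (t n / 2) (t n)))) (A : ℝ)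
    {δ : ℝ} (hδ : 0 < δ) :
    ∀ᶠ n in atTop, ∀ x ∈ Icc 0 (t n / 2), ∀ y ∈ Icc 0 (t n / 2), |x - y| ≤ A →
      |l (t n - x) - l (t n - y)| ≤ δ := by
  by_contra hcon
  have hfreq := (not_eventually.1 hcon).and_eventually (ht.eventually_ge_atTop 2)
  obtain ⟨ψ, hψ, hbad⟩ := extraction_of_frequently_atTop hfreq
  push Not at hbad
  choose x hx y hy hxy hlt using fun n => (hbad n).1
  have ht2 : ∀ n, 2 ≤ t (ψ n) := fun n => (hbad n).2
  have htψ : Tendsto (fun n => t (ψ n) / 2) atTop atTop :=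
    (ht.comp hψ.tendsto_atTop).atTop_div_const two_pos
  have key := hl.tendsto_sub (a := fun n => t (ψ n) - x n) (b := fun n => t (ψ n) - y n)
    (w := fun n => t (ψ n) - max (x n) 1) (R := A + 1) (L := 1 / 2)
    (tendsto_atTop_mono (fun n => by linarith [(hx n).2]) htψ)
    (tendsto_atTop_mono (fun n => by linarith [(hy n).2]) htψ) (by norm_num)
    (fun n => by
      have := (abs_nonneg _).trans (hxy n)
      have h0 := (hx n).1
      rw [abs_le]
      rcases max_cases (x n) 1 with h | h <;> constructor <;> linarith)
    (fun n => by
      have h1 := abs_le.1 (hxy n)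
      have h0 := (hx n).1
      rw [abs_le]
      rcases max_cases (x n) 1 with h | h <;> constructor <;> linarith)
    (fun n => (hm (ψ n)).mono_set (fun z hz => by
      have h1 := ht2 n
      have h2 := (hx n).2
      obtain ⟨h3, h4⟩ := hz
      rcases max_cases (x n) 1 with h | h <;> constructor <;> linarith))
  have := key.abs.eventually_lt_const (by simpa using hδ)
  obtain ⟨n, hn⟩ := this.exists
  exact absurd hn (not_lt.2 (hlt n).le)

/-- A bounded weight `k` of mean zero on a block `[c, c + T]` integrates to little against a
function which is almost constant there. -/
theorem abs_integral_mul_le_of_almost_constant {W k : ℝ → ℝ} {c T M δ : ℝ} (hT : 0 ≤ T)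
    (hW : ∀ x, 0 < W x) (hWi : IntervalIntegrable W volume c (c + T)) (hk : Continuous k)
    (hkM : ∀ x, |k x| ≤ M) (hk0 : ∫ x in c..c + T, k x = 0)
    (hδ : ∀ x ∈ Icc c (c + T), |log (W x) - log (W c)| ≤ δ) :
    |∫ x in c..c + T, W x * k x| ≤ M * (exp δ - 1) * ∫ x in c..c + T, W x := by
  have hcT : c ≤ c + T := by linarith
  have hM : 0 ≤ M := (abs_nonneg _).trans (hkM 0)
  have h1 : ∫ x in c..c + T, W x * k x = ∫ x in c..c + T, (W x - W c) * k x := by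
    simp_rw [sub_mul]
    rw [intervalIntegral.integral_sub (hWi.mul_continuousOn hk.continuousOn)
      ((hk.intervalIntegrable _ _).const_mul _), intervalIntegral.integral_const_mul, hk0]
    ring
  rw [h1, ← intervalIntegral.integral_const_mul]
  refine (intervalIntegral.abs_integral_le_integral_abs hcT).trans ?_
  refine intervalIntegral.integral_mono_on hcT
    (((hWi.sub intervalIntegrable_const).mul_continuousOn hk.continuousOn).abs)
    (hWi.const_mul _) fun x hx => ?_
  have h2 : |W x - W c| ≤ (exp δ - 1) * W x := by
    have h3 := abs_le.1 (hδ x hx)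
    have h4 : W c ≤ exp δ * W x := by
      rw [← exp_log (hW c), ← exp_log (hW x), ← exp_add]
      exact exp_le_exp.2 (by linarith)
    have h5 : W x ≤ exp δ * W c := by
      rw [← exp_log (hW c), ← exp_log (hW x), ← exp_add]
      exact exp_le_exp.2 (by linarith)
    have h6 : 1 ≤ exp δ := one_le_exp (by linarith)
    have h7 := hW x
    have h8 := hW c
    rw [abs_le]
    constructor
    · linarith
    · by_cases h : W x ≤ W c
      · nlinarith
      · nlinarith
  rw [abs_mul]
  calc |W x - W c| * |k x| ≤ ((exp δ - 1) * W x) * M :=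
        mul_le_mul h2 (hkM x) (abs_nonneg _) ((abs_nonneg _).trans h2)
    _ = _ := by ring

theorem abs_integral_mul_periodic_le {W k : ℝ → ℝ} {X T M δ B : ℝ} (hX : 0 ≤ X) (hT : 0 < T)
    (hXB : X + T ≤ B) (hW : ∀ x, 0 < W x) (hWi : IntervalIntegrable W volume 0 B)
    (hk : Continuous k) (hkM : ∀ x, |k x| ≤ M) (hk0 : ∀ c, ∫ x in c..c + T, k x = 0)
    (hδ0 : 0 ≤ δ)
    (hδ : ∀ x, X ≤ x → ∀ u ∈ Icc 0 T, x + u ≤ B → |log (W (x + u)) - log (W x)| ≤ δ) :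
    |∫ x in 0..B, W x * k x| ≤
      M * (∫ x in 0..X + T, W x) + M * (exp δ - 1) * ∫ x in 0..B, W x := by
  have hM : 0 ≤ M := (abs_nonneg _).trans (hkM 0)
  have he : 0 ≤ exp δ - 1 := by linarith [one_le_exp hδ0]
  have hsub : ∀ {a b}, 0 ≤ a → a ≤ b → b ≤ B → IntervalIntegrable W volume a b := by
    intro a b ha hab hb
    refine hWi.mono_set ?_
    rw [uIcc_of_le hab, uIcc_of_le (ha.trans (hab.trans hb))]
    exact Icc_subset_Icc ha hb
  have key : ∀ n : ℕ, ∀ b, 0 ≤ b → b ≤ B → b ≤ X + (n + 1) * T →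
      |∫ x in 0..b, W x * k x| ≤
        M * (∫ x in 0..X + T, W x) + M * (exp δ - 1) * ∫ x in 0..b, W x := by
    have hbase : ∀ b, 0 ≤ b → b ≤ X + T → |∫ x in 0..b, W x * k x| ≤
        M * (∫ x in 0..X + T, W x) + M * (exp δ - 1) * ∫ x in 0..b, W x := by
      intro b hb0 hb
      have hbi := hsub le_rfl hb0 (hb.trans hXB)
      have h1 : |∫ x in 0..b, W x * k x| ≤ ∫ x in 0..b, M * W x := by
        refine (intervalIntegral.abs_integral_le_integral_abs hb0).trans ?_
        refine intervalIntegral.integral_mono_on hb0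
          ((hbi.mul_continuousOn hk.continuousOn).abs) (hbi.const_mul _) fun x _ => ?_
        rw [abs_mul, abs_of_pos (hW x), mul_comm]
        exact mul_le_mul_of_nonneg_right (hkM x) (hW x).le
      have h2 : ∫ x in 0..b, W x ≤ ∫ x in 0..X + T, W x :=
        intervalIntegral.integral_mono_interval le_rfl hb0 hb
          (Eventually.of_forall fun x => (hW x).le) (hsub le_rfl (hb0.trans hb) hXB)
      have h3 : 0 ≤ ∫ x in 0..b, W x :=
        intervalIntegral.integral_nonneg hb0 fun x _ => (hW x).le
      rw [intervalIntegral.integral_const_mul] at h1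
      have := mul_le_mul_of_nonneg_left h2 hM
      have := mul_nonneg (mul_nonneg hM he) h3
      linarith
    intro n
    induction n with
    | zero =>
      intro b hb0 _ hb
      exact hbase b hb0 (by simpa using hb)
    | succ n ih =>
      intro b hb0 hbB hb
      by_cases hbX : b ≤ X + T
      · exact hbase b hb0 hbX
      push Not at hbX
      have hc0 : 0 ≤ b - T := by linarith
      have hcb : b - T ≤ b := by linarith
      have h1 := ih (b - T) hc0 (by linarith) (by push_cast at hb; linarith)
      have hi1 := hsub le_rfl hc0 (by linarith)
      have hi2 := hsub hc0 hcb hbB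
      have h2 := abs_integral_mul_le_of_almost_constant (c := b - T) (M := M) (δ := δ) hT.le hW
        (by simpa using hi2) hk hkM (hk0 _) (fun x hx => by
          have := hδ (b - T) (by linarith) (x - (b - T)) ⟨by linarith [hx.1], by linarith [hx.2]⟩
            (by linarith [hx.2])
          simpa using this)
      rw [sub_add_cancel] at h2
      rw [← intervalIntegral.integral_add_adjacent_intervals hi1 hi2,
        ← intervalIntegral.integral_add_adjacent_intervals
          (hi1.mul_continuousOn hk.continuousOn) (hi2.mul_continuousOn hk.continuousOn), mul_add]
      refine (abs_add_le _ _).trans ?_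
      linarith
  obtain ⟨n, hn⟩ := exists_nat_ge ((B - X) / T)
  refine key n B (by linarith) le_rfl ?_
  rw [div_le_iff₀ hT] at hn
  linarith

section Sequence

variable {f g : ℝ → ℝ} {t : ℕ → ℝ}

theorem tendsto_div_of_addSlowVar (hg0 : ∀ x, 0 < g x)
    (hg : AddSlowVar fun x => log (g x)) (ht : Tendsto t atTop atTop) (u : ℝ) :
    Tendsto (fun n => g (t n - u) / g (t n)) atTop (nhds 1) := by
  have h := (continuous_exp.tendsto 0).comp ((hg (-u)).comp ht)
  rw [exp_zero] at h
  refine h.congr fun n => ?_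
  simp only [Function.comp_apply, ← sub_eq_add_neg]
  rw [exp_sub, exp_log (hg0 _), exp_log (hg0 _)]

/-- If the products `f x * g (t n - x)` are measurable, then so is `f`, as their limit. -/
theorem aemeasurable_left_of_products (hg0 : ∀ x, 0 < g x)
    (hg : AddSlowVar fun x => log (g x)) (ht : Tendsto t atTop atTop)
    (hm : ∀ n, AEMeasurable (fun x => f x * g (t n - x)) (volume.restrict (Ioc 0 (t n / 2))))
    (A : ℝ) : AEMeasurable f (volume.restrict (Ioc 0 A)) := by
  obtain ⟨N, hN⟩ := eventually_atTop.1 (ht.eventually_ge_atTop (2 * A))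
  refine aemeasurable_of_tendsto_metrizable_ae atTop
    (f := fun n x => f x * g (t (n + N) - x) / g (t (n + N))) (fun n => ?_)
    (Eventually.of_forall fun x => ?_)
  · refine ((hm (n + N)).mono_set (Ioc_subset_Ioc_right ?_)).div_const _
    linarith [hN (n + N) (Nat.le_add_left _ _)]
  · have h := (tendsto_div_of_addSlowVar hg0 hg (ht.comp (tendsto_add_atTop_nat N)) x).const_mul
      (f x)
    simpa [mul_div_assoc] using h

theorem aemeasurable_right_of_products (hf0 : ∀ x, 0 < f x) {τ : ℝ}
    (hf : AEMeasurable f (volume.restrict (Ioc 0 (τ / 2))))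
    (hm : AEMeasurable (fun x => f x * g (τ - x)) (volume.restrict (Ioc 0 (τ / 2)))) :
    AEMeasurable g (volume.restrict (Ico (τ / 2) τ)) := by
  have h1 : AEMeasurable (fun x => g (τ - x)) (volume.restrict (Ioc 0 (τ / 2))) :=
    (hm.div hf).congr (Eventually.of_forall fun x => by
      simp [mul_div_cancel_left₀ _ (hf0 x).ne'])
  have hpre : (fun y => τ - y) ⁻¹' Ioc 0 (τ / 2) = Ico (τ / 2) τ := by
    ext y
    simp only [mem_preimage, mem_Ioc, mem_Ico]
    constructor <;> rintro ⟨_, _⟩ <;> constructor <;> linarith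
  have h2 := h1.comp_quasiMeasurePreserving
    ((Measure.measurePreserving_sub_left volume τ).restrict_preimage
      measurableSet_Ioc).quasiMeasurePreserving
  rw [hpre] at h2
  simpa [Function.comp_def] using h2

theorem eventually_abs_integral_products_le (hf0 : ∀ x, 0 < f x) (hg0 : ∀ x, 0 < g x)
    (hf : AddSlowVar fun x => log (f x)) (hg : AddSlowVar fun x => log (g x))
    (hdiv : ¬ IntegrableOn f (Ioi 0)) (ht : Tendsto t atTop atTop)
    (hi : ∀ n, IntervalIntegrable (fun x => f x * g (t n - x)) volume 0 (t n / 2))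
    {k : ℕ → ℝ → ℝ} {T M : ℝ} (hT : 0 < T) (hk : ∀ n, Continuous (k n))
    (hkM : ∀ n x, |k n x| ≤ M) (hk0 : ∀ n c, ∫ x in c..c + T, k n x = 0)
    {ε : ℝ} (hε : 0 < ε) :
    ∀ᶠ n in atTop, |∫ x in 0..t n / 2, f x * g (t n - x) * k n x| ≤
      ε * ∫ x in 0..t n / 2, f x * g (t n - x) := by
  have hM : 0 ≤ M := (abs_nonneg _).trans (hkM 0 0)
  have hm : ∀ n, AEMeasurable (fun x => f x * g (t n - x))
      (volume.restrict (Ioc 0 (t n / 2))) := fun n => (hi n).aestronglyMeasurable.aemeasurable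
  have hfm := aemeasurable_left_of_products hg0 hg ht hm
  have hgm := fun n => aemeasurable_right_of_products hf0 (hfm _) (hm n)
  have hcomp : ∀ A, ∀ᶠ n in atTop, ∀ x ∈ Icc 0 A,
      g (t n - x) ≤ exp 1 * g (t n) ∧ g (t n) ≤ exp 1 * g (t n - x) := by
    intro A
    filter_upwards [hg.eventually_forall_abs_sub_le ht
      (fun n => measurable_log.comp_aemeasurable (hgm n)) A one_pos,
      ht.eventually_ge_atTop (2 * A)] with n hn htn x hx
    have h := hn x ⟨hx.1, by linarith [hx.2]⟩ 0 ⟨le_rfl, by linarith [hx.1, hx.2]⟩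
      (by simpa [abs_of_nonneg hx.1] using hx.2)
    rw [sub_zero, abs_le] at h
    constructor
    · rw [← exp_log (hg0 (t n - x)), ← exp_log (hg0 (t n)), ← exp_add]
      exact exp_le_exp.2 (by linarith)
    · rw [← exp_log (hg0 (t n - x)), ← exp_log (hg0 (t n)), ← exp_add]
      exact exp_le_exp.2 (by linarith)
  have hsub : ∀ n A, 0 ≤ A → 2 * A ≤ t n →
      IntervalIntegrable (fun x => f x * g (t n - x)) volume 0 A := by
    intro n A hA hAt
    refine (hi n).mono_set ?_
    rw [uIcc_of_le hA, uIcc_of_le (by linarith)]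
    exact Icc_subset_Icc le_rfl (by linarith)
  have hfi : ∀ A, 0 ≤ A → IntervalIntegrable f volume 0 A := by
    intro A hA
    obtain ⟨n, hn, htn⟩ := ((hcomp A).and (ht.eventually_ge_atTop (2 * A))).exists
    refine ((hsub n A hA htn).const_mul (exp 1 / g (t n))).mono_fun' ?_ ?_
    · rw [uIoc_of_le hA]; exact (hfm A).aestronglyMeasurable
    · rw [uIoc_of_le hA]
      filter_upwards [ae_restrict_mem measurableSet_Ioc] with x hx
      have h1 := (hn x ⟨hx.1.le, hx.2⟩).2
      have h2 := hf0 x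
      rw [norm_of_nonneg h2.le, div_mul_eq_mul_div, le_div_iff₀ (hg0 _)]
      nlinarith
  have hlarge : ∀ B, ∃ A, 0 ≤ A ∧ B ≤ ∫ x in 0..A, f x := by
    intro B
    by_contra! hcon
    refine hdiv (integrableOn_Ioi_of_intervalIntegral_norm_bounded (l := atTop)
      (b := fun n : ℕ => (n : ℝ)) B 0 (fun n => ?_) tendsto_natCast_atTop_atTop
      (Eventually.of_forall fun n => ?_))
    · exact (hfi n n.cast_nonneg).1
    · simp_rw [norm_of_nonneg (hf0 _).le]
      exact (hcon n n.cast_nonneg).le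
  obtain ⟨δ, hδ, hδε⟩ : ∃ δ, 0 < δ ∧ M * (exp δ - 1) ≤ ε / 2 := by
    have hlim : Tendsto (fun δ => M * (exp δ - 1)) (nhdsWithin 0 (Ioi 0)) (nhds 0) := by
      have : Continuous fun δ => M * (exp δ - 1) := by fun_prop
      simpa using (this.tendsto 0).mono_left nhdsWithin_le_nhds
    obtain ⟨δ, h1, h2⟩ := ((hlim.eventually_lt_const (half_pos hε)).and
      self_mem_nhdsWithin).exists
    exact ⟨δ, h2, h1.le⟩
  obtain ⟨X, hX, hfX⟩ := hf.exists_forall_abs_sub_le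
    (fun A => measurable_log.comp_aemeasurable (hfm A)) T (half_pos hδ)
  obtain ⟨A, hA, hfA⟩ := hlarge (2 * M * exp 1 * exp 1 / ε * ∫ x in 0..X + T, f x)
  have hXT : 0 ≤ X + T := by linarith
  filter_upwards [hg.eventually_forall_abs_sub_le ht
      (fun n => measurable_log.comp_aemeasurable (hgm n)) T (half_pos hδ), hcomp A,
    hcomp (X + T), ht.eventually_ge_atTop (2 * A), ht.eventually_ge_atTop (2 * (X + T))]
    with n hgn hnA hnX htA htX
  set W : ℝ → ℝ := fun x => f x * g (t n - x) with hWdef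
  have hW0 : ∀ x, 0 < W x := fun x => mul_pos (hf0 x) (hg0 _)
  have hblocks := abs_integral_mul_periodic_le hX hT (by linarith) hW0 (hi n) (hk n) (hkM n)
    (hk0 n) hδ.le (fun x hx u hu hxu => by
      have h1 := abs_le.1 (hfX x hx u hu)
      have h2 := abs_le.1 (hgn (x + u) ⟨by linarith [hu.1], hxu⟩ x
        ⟨by linarith, by linarith [hu.1]⟩
        (by rw [add_sub_cancel_left, abs_of_nonneg hu.1]; exact hu.2))
      rw [hWdef]
      simp only
      rw [log_mul (hf0 _).ne' (hg0 _).ne', log_mul (hf0 _).ne' (hg0 _).ne', abs_le]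
      constructor <;> linarith)
  have hinit : ∫ x in 0..X + T, W x ≤ exp 1 * g (t n) * ∫ x in 0..X + T, f x := by
    rw [← intervalIntegral.integral_const_mul]
    refine intervalIntegral.integral_mono_on hXT (hsub n _ hXT htX)
      ((hfi _ hXT).const_mul _) fun x hx => ?_
    exact (mul_le_mul_of_nonneg_left (hnX x hx).1 (hf0 x).le).trans_eq (mul_comm _ _)
  have htotal : g (t n) * ∫ x in 0..A, f x ≤ exp 1 * ∫ x in 0..t n / 2, W x := by
    have h1 : g (t n) * ∫ x in 0..A, f x ≤ exp 1 * ∫ x in 0..A, W x := by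
      rw [← intervalIntegral.integral_const_mul, ← intervalIntegral.integral_const_mul]
      refine intervalIntegral.integral_mono_on hA ((hfi _ hA).const_mul _)
        ((hsub n _ hA htA).const_mul _) fun x hx => ?_
      have h2 := (hnA x hx).2
      have h3 := hf0 x
      simp only [hWdef]
      nlinarith
    refine h1.trans (mul_le_mul_of_nonneg_left ?_ (exp_pos 1).le)
    exact intervalIntegral.integral_mono_interval le_rfl hA (by linarith)
      (Eventually.of_forall fun x => (hW0 x).le) (hi n)
  have hsmall : M * (∫ x in 0..X + T, W x) ≤ ε / 2 * ∫ x in 0..t n / 2, W x := by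
    set F := ∫ x in 0..X + T, f x
    have h1 : 2 * M * exp 1 * exp 1 * F ≤ ε * ∫ x in 0..A, f x := by
      rw [div_mul_eq_mul_div, div_le_iff₀ hε] at hfA
      linarith
    have h2 := mul_le_mul_of_nonneg_left h1 (hg0 (t n)).le
    have h3 := mul_le_mul_of_nonneg_left htotal hε.le
    have h4 := mul_le_mul_of_nonneg_left hinit hM
    refine h4.trans ?_
    have h5 : exp 1 * (2 * (M * (exp 1 * g (t n) * F))) ≤
        exp 1 * (ε * ∫ x in 0..t n / 2, W x) := by nlinarith
    linarith [le_of_mul_le_mul_left h5 (exp_pos 1)]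
  have hnn : 0 ≤ ∫ x in 0..t n / 2, W x :=
    intervalIntegral.integral_nonneg (by linarith) fun x _ => (hW0 x).le
  have := mul_le_mul_of_nonneg_right hδε hnn
  linarith

end Sequence

section PeriodicConvolution

variable {s st : ℝ → ℝ} {T : ℝ}

theorem periodConv_comm (hsper : Function.Periodic s T) (hstper : Function.Periodic st T)
    (η : ℝ) : periodConv s st T η = periodConv st s T η := by
  have hper : Function.Periodic (fun x => st (η - x) * s x) T := fun x => by
    simp only
    rw [hsper x, show η - (x + T) = η - x - T by ring, hstper.sub_eq]
  have h1 := intervalIntegral.integral_comp_sub_left (a := 0) (b := T)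
    (fun x => st (η - x) * s x) η
  have h2 := hper.intervalIntegral_add_eq (η - T) 0
  simp only [sub_sub_cancel, sub_zero] at h1
  simp only [sub_add_cancel, zero_add] at h2
  rw [periodConv, periodConv, ← h2, ← h1]
  simp_rw [mul_comm]

theorem periodConv_mem_Icc (hT : 0 < T) (hs : Continuous s) (hst : Continuous st) {η m M : ℝ}
    (hb : ∀ x, s (η - x) * st x ∈ Icc m M) : periodConv s st T η ∈ Icc m M := by
  have hc : Continuous fun x => s (η - x) * st x := by fun_prop
  have h1 := intervalIntegral.integral_mono_on (μ := volume) hT.le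
    (intervalIntegrable_const (c := m)) (hc.intervalIntegrable 0 T) fun x _ => (hb x).1
  have h2 := intervalIntegral.integral_mono_on (μ := volume) hT.le (hc.intervalIntegrable 0 T)
    (intervalIntegrable_const (c := M)) fun x _ => (hb x).2
  rw [intervalIntegral.integral_const, sub_zero, smul_eq_mul] at h1 h2
  rw [periodConv, one_div, inv_mul_eq_div, mem_Icc, le_div_iff₀ hT, div_le_iff₀ hT]
  constructor <;> linarith

theorem integral_sub_periodConv (hT : 0 < T) (hs : Continuous s) (hst : Continuous st)
    (hsper : Function.Periodic s T) (hstper : Function.Periodic st T) (η c : ℝ) :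
    ∫ x in c..c + T, (s (η - x) * st x - periodConv s st T η) = 0 := by
  have hc : Continuous fun x => s (η - x) * st x := by fun_prop
  have hper : Function.Periodic (fun x => s (η - x) * st x) T := fun x => by
    simp only
    rw [hstper x, show η - (x + T) = η - x - T by ring, hsper.sub_eq]
  rw [intervalIntegral.integral_sub (hc.intervalIntegrable _ _) intervalIntegrable_const,
    hper.intervalIntegral_add_eq c 0, intervalIntegral.integral_const, periodConv, zero_add,
    smul_eq_mul]
  field_simp
  ring

/-- The additive form of the asymptotics over half of the range, valid at those `t` for which
the convolution integral converges. -/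
theorem eventually_abs_integral_sub_periodConv_le {f g : ℝ → ℝ} (hf0 : ∀ x, 0 < f x)
    (hg0 : ∀ x, 0 < g x) (hf : AddSlowVar fun x => log (f x))
    (hg : AddSlowVar fun x => log (g x)) (hdiv : ¬ IntegrableOn f (Ioi 0)) (hT : 0 < T)
    (hs : Continuous s) (hst : Continuous st) (hsper : Function.Periodic s T)
    (hstper : Function.Periodic st T) {m M : ℝ} (hm : 0 ≤ m)
    (hb : ∀ x y, s x * st y ∈ Icc m M) {ε : ℝ} (hε : 0 < ε) :
    ∀ᶠ t in atTop, IntervalIntegrable (fun x => f x * g (t - x)) volume 0 (t / 2) →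
      |(∫ x in 0..t / 2, f x * g (t - x) * (s (t - x) * st x)) -
        (∫ x in 0..t / 2, f x * g (t - x)) * periodConv s st T t| ≤
        ε * ∫ x in 0..t / 2, f x * g (t - x) := by
  by_contra hcon
  obtain ⟨t, ht, hbad⟩ := exists_seq_forall_of_frequently (not_eventually.1 hcon)
  push Not at hbad
  have hkey := eventually_abs_integral_products_le hf0 hg0 hf hg hdiv ht (fun n => (hbad n).1)
    (k := fun n x => s (t n - x) * st x - periodConv s st T (t n)) (M := M) hT
    (fun n => by fun_prop)
    (fun n x => by
      have h1 := hb (t n - x) x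
      have h2 := periodConv_mem_Icc hT hs hst (η := t n) fun x => hb (t n - x) x
      rw [abs_le]
      constructor <;> linarith [h1.1, h1.2, h2.1, h2.2])
    (fun n c => integral_sub_periodConv hT hs hst hsper hstper (t n) c) hε
  obtain ⟨n, hn⟩ := hkey.exists
  refine absurd hn (not_le.2 ((hbad n).2.trans_eq ?_))
  have hc : Continuous fun x => s (t n - x) * st x := by fun_prop
  simp_rw [mul_sub]
  rw [intervalIntegral.integral_sub ((hbad n).1.mul_continuousOn hc.continuousOn)
    ((hbad n).1.mul_const _), intervalIntegral.integral_mul_const]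

theorem integral_mul_eq_zero_of_not_intervalIntegrable {W K : ℝ → ℝ} {a b : ℝ}
    (hK : Continuous K) (hK0 : ∀ x, K x ≠ 0) (hW : ¬ IntervalIntegrable W volume a b) :
    ∫ x in a..b, W x * K x = 0 := by
  refine intervalIntegral.integral_undef fun h => hW ?_
  have := h.mul_continuousOn (hK.inv₀ hK0).continuousOn
  simpa [mul_assoc, mul_inv_cancel₀ (hK0 _)] using this

theorem eventually_abs_half_convolution_le {f g : ℝ → ℝ} (hf0 : ∀ x, 0 < f x)
    (hg0 : ∀ x, 0 < g x) (hf : AddSlowVar fun x => log (f x))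
    (hg : AddSlowVar fun x => log (g x)) (hdiv : ¬ IntegrableOn f (Ioi 0)) (hT : 0 < T)
    (hs : Continuous s) (hst : Continuous st) (hsper : Function.Periodic s T)
    (hstper : Function.Periodic st T) {m M : ℝ} (hm : 0 < m)
    (hb : ∀ x y, s x * st y ∈ Icc m M) {ε : ℝ} (hε : 0 < ε) :
    ∀ᶠ t in atTop,
      |(∫ x in 0..t / 2, f x * g (t - x) * (s (t - x) * st x)) -
        (∫ x in 0..t / 2, f x * g (t - x)) * periodConv s st T t| ≤
        ε * |(∫ x in 0..t / 2, f x * g (t - x)) * periodConv s st T t| := by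
  filter_upwards [eventually_abs_integral_sub_periodConv_le hf0 hg0 hf hg hdiv hT hs hst hsper
    hstper hm.le hb (mul_pos hε hm), eventually_ge_atTop 0] with t ht ht0
  by_cases hi : IntervalIntegrable (fun x => f x * g (t - x)) volume 0 (t / 2)
  · have hC := periodConv_mem_Icc hT hs hst (η := t) fun x => hb (t - x) x
    have hnn : 0 ≤ ∫ x in 0..t / 2, f x * g (t - x) :=
      intervalIntegral.integral_nonneg (by linarith) fun x _ => (mul_pos (hf0 x) (hg0 _)).le
    rw [abs_of_nonneg (mul_nonneg hnn (hm.le.trans hC.1))]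
    refine (ht hi).trans ?_
    have := mul_le_mul_of_nonneg_left hC.1 (mul_nonneg hε.le hnn)
    linarith
  · rw [integral_mul_eq_zero_of_not_intervalIntegrable (K := fun x => s (t - x) * st x)
      (by fun_prop) (fun x => (hm.trans_le (hb _ _).1).ne') hi, intervalIntegral.integral_undef hi]
    simp

theorem eventually_abs_full_convolution_le {f g : ℝ → ℝ} (hf0 : ∀ x, 0 < f x)
    (hg0 : ∀ x, 0 < g x) (hf : AddSlowVar fun x => log (f x))
    (hg : AddSlowVar fun x => log (g x)) (hdivf : ¬ IntegrableOn f (Ioi 0))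
    (hdivg : ¬ IntegrableOn g (Ioi 0)) (hT : 0 < T)
    (hs : Continuous s) (hst : Continuous st) (hsper : Function.Periodic s T)
    (hstper : Function.Periodic st T) {m M : ℝ} (hm : 0 < m)
    (hb : ∀ x y, s x * st y ∈ Icc m M) {ε : ℝ} (hε : 0 < ε) :
    ∀ᶠ t in atTop,
      |(∫ x in 0..t, f x * g (t - x) * (s (t - x) * st x)) -
        (∫ x in 0..t, f x * g (t - x)) * periodConv s st T t| ≤
        ε * |(∫ x in 0..t, f x * g (t - x)) * periodConv s st T t| := by
  filter_upwards [eventually_abs_half_convolution_le hf0 hg0 hf hg hdivf hT hs hst hsper hstper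
    hm hb hε, eventually_abs_half_convolution_le hg0 hf0 hg hf hdivg hT hst hs hstper hsper
    hm (fun x y => by rw [mul_comm]; exact hb y x) hε, eventually_ge_atTop 0] with t h1 h2 ht0
  by_cases hi : IntervalIntegrable (fun x => f x * g (t - x)) volume 0 t
  · have hc : Continuous fun x => s (t - x) * st x := by fun_prop
    have hl : IntervalIntegrable (fun x => f x * g (t - x)) volume 0 (t / 2) := by
      refine hi.mono_set ?_
      rw [uIcc_of_le (by linarith), uIcc_of_le ht0]
      exact Icc_subset_Icc le_rfl (by linarith)
    have hr : IntervalIntegrable (fun x => f x * g (t - x)) volume (t / 2) t := by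
      refine hi.mono_set ?_
      rw [uIcc_of_le (by linarith), uIcc_of_le ht0]
      exact Icc_subset_Icc (by linarith) le_rfl
    have hC := periodConv_mem_Icc hT hs hst (η := t) fun x => hb (t - x) x
    have e1 := intervalIntegral.integral_comp_sub_left (a := 0) (b := t / 2)
      (fun x => f x * g (t - x)) t
    have e2 := intervalIntegral.integral_comp_sub_left (a := 0) (b := t / 2)
      (fun x => f x * g (t - x) * (s (t - x) * st x)) t
    simp only [sub_sub_cancel, sub_zero, sub_half] at e1 e2
    have e1' : ∫ x in 0..t / 2, g x * f (t - x) = ∫ x in t / 2..t, f x * g (t - x) := by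
      rw [← e1]
      exact intervalIntegral.integral_congr fun x _ => mul_comm _ _
    have e2' : ∫ x in 0..t / 2, g x * f (t - x) * (st (t - x) * s x) =
        ∫ x in t / 2..t, f x * g (t - x) * (s (t - x) * st x) := by
      rw [← e2]
      exact intervalIntegral.integral_congr fun x _ => by ring
    rw [e1', e2', periodConv_comm hstper hsper] at h2
    rw [← intervalIntegral.integral_add_adjacent_intervals hl hr,
      ← intervalIntegral.integral_add_adjacent_intervals (hl.mul_continuousOn hc.continuousOn)
        (hr.mul_continuousOn hc.continuousOn)]
    have hC0 : 0 ≤ periodConv s st T t := hm.le.trans hC.1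
    have n1 : 0 ≤ ∫ x in 0..t / 2, f x * g (t - x) :=
      intervalIntegral.integral_nonneg (by linarith) fun x _ => (mul_pos (hf0 x) (hg0 _)).le
    have n2 : 0 ≤ ∫ x in t / 2..t, f x * g (t - x) :=
      intervalIntegral.integral_nonneg (by linarith) fun x _ => (mul_pos (hf0 x) (hg0 _)).le
    rw [abs_of_nonneg (mul_nonneg n1 hC0)] at h1
    rw [abs_of_nonneg (mul_nonneg n2 hC0)] at h2
    rw [abs_of_nonneg (mul_nonneg (add_nonneg n1 n2) hC0)]
    rw [abs_le] at *
    constructor <;> linarith [h1.1, h1.2, h2.1, h2.2]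
  · rw [integral_mul_eq_zero_of_not_intervalIntegrable (K := fun x => s (t - x) * st x)
      (by fun_prop) (fun x => (hm.trans_le (hb _ _).1).ne') hi, intervalIntegral.integral_undef hi]
    simp

end PeriodicConvolution

theorem integral_Ioc_one_exp (G : ℝ → ℝ) {b : ℝ} (hb : 0 ≤ b) :
    ∫ σ in Ioc 1 (exp b), G σ / σ = ∫ x in 0..b, G (exp x) := by
  have himg : exp '' Ioc 0 b = Ioc 1 (exp b) := by
    ext y
    constructor
    · rintro ⟨x, hx, rfl⟩
      exact ⟨one_lt_exp_iff.2 hx.1, exp_le_exp.2 hx.2⟩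
    · rintro ⟨h1, h2⟩
      have hy : 0 < y := one_pos.trans h1
      exact ⟨log y, ⟨log_pos h1, (log_le_iff_le_exp hy).2 h2⟩, exp_log hy⟩
  rw [← himg, integral_image_eq_integral_abs_deriv_smul measurableSet_Ioc
    (fun x _ => (hasDerivAt_exp x).hasDerivWithinAt) exp_injective.injOn,
    intervalIntegral.integral_of_le hb]
  refine integral_congr_ae (Eventually.of_forall fun x => ?_)
  simp only [abs_exp, smul_eq_mul]
  exact mul_div_cancel₀ _ (exp_pos x).ne'

theorem not_integrableOn_comp_exp {ψ : ℝ → ℝ}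
    (h : ¬ IntegrableOn (fun τ => ψ τ / τ) (Ici 1)) :
    ¬ IntegrableOn (fun x => ψ (exp x)) (Ioi 0) := by
  have himg : exp '' Ioi 0 = Ioi 1 := by
    ext y
    constructor
    · rintro ⟨x, hx, rfl⟩
      exact one_lt_exp_iff.2 hx
    · intro h1
      exact ⟨log y, log_pos h1, exp_log (one_pos.trans h1)⟩
  rw [integrableOn_Ici_iff_integrableOn_Ioi, ← himg,
    integrableOn_image_iff_integrableOn_abs_deriv_smul measurableSet_Ioi
    (fun x _ => (hasDerivAt_exp x).hasDerivWithinAt) exp_injective.injOn] at h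
  refine fun hi => h (hi.congr (Eventually.of_forall fun x => ?_))
  simp only [abs_exp, smul_eq_mul]
  exact (mul_div_cancel₀ _ (exp_pos x).ne').symm

theorem IsSVF.addSlowVar_log {φ : ℝ → ℝ} (hφ : IsSVF φ) :
    AddSlowVar fun x => log (φ (exp x)) := by
  intro u
  have h := (continuousAt_log one_ne_zero).tendsto.comp
    ((hφ.2 (exp u) (exp_pos u)).comp tendsto_exp_atTop)
  rw [log_one] at h
  refine h.congr fun x => ?_
  simp only [Function.comp_apply]
  rw [log_div (hφ.1 _ (by positivity)).ne' (hφ.1 _ (exp_pos x)).ne', ← exp_add, add_comm u]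

/-- for a common period `T` and `∫_1^∞ φ̃(τ) dτ/τ = ∞`, the integral
`∫_1^{√τ} φ(τ/σ) s(ln(τ/σ)) φ̃(σ) s̃(ln σ) dσ/σ` is asymptotically
`h_{φ̃,φ}(τ)·(s ⋆ s̃)(ln τ)`; if moreover `∫_1^∞ φ(τ) dτ/τ = ∞`, the integral over
`(1, τ]` is asymptotically `(φ∗φ̃)(τ)·(s ⋆ s̃)(ln τ)`. -/
theorem stmt4 (p T : ℝ) (hp : 0 < p) (hT : 0 < T)
    (φ φt s st ρ ρt : ℝ → ℝ)
    (hφ : IsSVF φ) (hφt : IsSVF φt)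
    (hs : Continuous s) (hst : Continuous st)
    (hsper : Function.Periodic s T) (hstper : Function.Periodic st T)
    (hsb : ∃ m M : ℝ, 0 < m ∧ ∀ τ, m ≤ s τ ∧ s τ ≤ M)
    (hstb : ∃ m M : ℝ, 0 < m ∧ ∀ τ, m ≤ st τ ∧ st τ ≤ M)
    (hρ : Monotone ρ) (hρt : Monotone ρt)
    (hsform : ∀ τ, s τ = Real.exp (-τ / p) * ρ τ)
    (hstform : ∀ τ, st τ = Real.exp (-τ / p) * ρt τ)
    (hdivφt : ¬ MeasureTheory.IntegrableOn (fun τ => φt τ / τ) (Set.Ici 1)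
      MeasureTheory.volume) :
    ((fun τ => ∫ σ in Set.Ioc (1:ℝ) (Real.sqrt τ),
        φ (τ / σ) * s (Real.log (τ / σ)) * φt σ * st (Real.log σ) / σ) ~[atTop]
      (fun τ => mellinH φt φ τ * periodConv s st T (Real.log τ))) ∧
    (¬ MeasureTheory.IntegrableOn (fun τ => φ τ / τ) (Set.Ici 1) MeasureTheory.volume →
      (fun τ => ∫ σ in Set.Ioc (1:ℝ) τ,
          φ (τ / σ) * s (Real.log (τ / σ)) * φt σ * st (Real.log σ) / σ) ~[atTop]
        (fun τ => mellinConv φ φt τ * periodConv s st T (Real.log τ))) := by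
  obtain ⟨m, M, hm, hsb⟩ := hsb
  obtain ⟨mt, Mt, hmt, hstb⟩ := hstb
  have hb : ∀ x y, s x * st y ∈ Icc (m * mt) (M * Mt) := fun x y =>
    ⟨mul_le_mul (hsb x).1 (hstb y).1 hmt.le (hm.le.trans (hsb x).1),
      mul_le_mul (hsb x).2 (hstb y).2 (hmt.le.trans (hstb y).1)
        (hm.le.trans ((hsb x).1.trans (hsb x).2))⟩
  have hf0 : ∀ x, 0 < φt (exp x) := fun x => hφt.1 _ (exp_pos x)
  have hg0 : ∀ x, 0 < φ (exp x) := fun x => hφ.1 _ (exp_pos x)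
  have hweighted : ∀ {t b : ℝ}, 0 ≤ b →
      ∫ σ in Ioc 1 (exp b), φ (exp t / σ) * s (log (exp t / σ)) * φt σ * st (log σ) / σ =
        ∫ x in 0..b, φt (exp x) * φ (exp (t - x)) * (s (t - x) * st x) := by
    intro t b hb'
    rw [integral_Ioc_one_exp _ hb']
    refine intervalIntegral.integral_congr fun x _ => ?_
    simp only [← exp_sub, log_exp]
    ring
  have hsqrt : ∀ t, sqrt (exp t) = exp (t / 2) := fun t => (exp_half t).symm
  refine ⟨?_, fun hdivφ => ?_⟩
  · refine isLittleO_iff.2 fun ε hε => ?_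
    filter_upwards [tendsto_log_atTop.eventually (eventually_abs_half_convolution_le hf0 hg0
      hφt.addSlowVar_log hφ.addSlowVar_log (not_integrableOn_comp_exp hdivφt) hT hs hst hsper
      hstper (mul_pos hm hmt) hb hε), eventually_ge_atTop 1] with τ hτ hτ1
    obtain ⟨t, rfl⟩ : ∃ t, exp t = τ := ⟨log τ, exp_log (by linarith)⟩
    have ht : 0 ≤ t / 2 := by linarith [one_le_exp_iff.1 hτ1]
    rw [log_exp] at hτ
    simp only [Pi.sub_apply, mellinH, hsqrt, log_exp]
    rw [hweighted ht, integral_Ioc_one_exp _ ht]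
    simpa only [← exp_sub, norm_eq_abs] using hτ
  · refine isLittleO_iff.2 fun ε hε => ?_
    filter_upwards [tendsto_log_atTop.eventually (eventually_abs_full_convolution_le hf0 hg0
      hφt.addSlowVar_log hφ.addSlowVar_log (not_integrableOn_comp_exp hdivφt)
      (not_integrableOn_comp_exp hdivφ) hT hs hst hsper
      hstper (mul_pos hm hmt) hb hε), eventually_ge_atTop 1] with τ hτ hτ1
    obtain ⟨t, rfl⟩ : ∃ t, exp t = τ := ⟨log τ, exp_log (by linarith)⟩
    have ht : 0 ≤ t := one_le_exp_iff.1 hτ1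
    rw [log_exp] at hτ
    have hswap := intervalIntegral.integral_comp_sub_left (a := 0) (b := t)
      (fun x => φt (exp x) * φ (exp (t - x))) t
    simp only [sub_sub_cancel, sub_zero, sub_self] at hswap
    simp only [Pi.sub_apply, mellinConv, log_exp]
    rw [hweighted ht, integral_Ioc_one_exp _ ht]
    simp only [← exp_sub, norm_eq_abs]
    simp_rw [mul_comm (φ (exp _)) (φt (exp _))]
    rwa [hswap]
end
end

section
/- Let s and s̃ have a common period T. Then the function s ⋆ s̃ is continuously differentiable on ℝ and (s ⋆ s̃)'(η) = (1/T)∫_0^T s(η − λ) d(s̃(λ)) = −(1/p)·(s ⋆ s̃)(η) + e^{−η/p}·(1/T)∫_0^T ρ(η − λ) d(ρ̃(λ)), where the integrals against d(s̃) and d(ρ̃) are Lebesgue–Stieltjes integrals. -/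
open MeasureTheory Filter Real Set Asymptotics

noncomputable section

theorem isFiniteMeasure_restrict_Ioc_of_isStieltjesOf {ν : Measure ℝ} {ρ : ℝ → ℝ}
    (hν : IsStieltjesOf ν ρ) {a b : ℝ} (hab : a ≤ b) : IsFiniteMeasure (ν.restrict (Ioc a b)) := by
  refine ⟨?_⟩
  rw [Measure.restrict_apply_univ, hν a b hab]
  exact ENNReal.ofReal_lt_top

/-- Fubini's theorem on the triangle `{(x, y) : a < y ≤ x ≤ b}`. -/
theorem integral_mul_measureReal_Ioc {ν : Measure ℝ} {a b : ℝ}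
    [IsFiniteMeasure (ν.restrict (Ioc a b))] {f : ℝ → ℝ} (hf : Continuous f) :
    ∫ x in Ioc a b, f x * ν.real (Ioc a x) = ∫ y in Ioc a b, (∫ x in y..b, f x) ∂ν := by
  have hmeas : MeasurableSet {q : ℝ × ℝ | q.2 ≤ q.1} := measurableSet_le measurable_snd measurable_fst
  have hint : Integrable (Function.uncurry fun x y => (Iic x).indicator (fun _ => f x) y)
      ((volume.restrict (Ioc a b)).prod (ν.restrict (Ioc a b))) := by
    have h1 : Integrable (fun q : ℝ × ℝ => f q.1)
        ((volume.restrict (Ioc a b)).prod (ν.restrict (Ioc a b))) :=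
      Integrable.comp_fst (hf.integrableOn_Ioc) _
    refine (h1.indicator hmeas).congr (Eventually.of_forall fun q => ?_)
    simp [Function.uncurry, indicator]
  have hswap := integral_integral_swap hint
  calc
    ∫ x in Ioc a b, f x * ν.real (Ioc a x)
      = ∫ x in Ioc a b, ∫ y in Ioc a b, (Iic x).indicator (fun _ => f x) y ∂ν := by
        refine setIntegral_congr_fun measurableSet_Ioc fun x hx => ?_
        rw [integral_indicator measurableSet_Iic, Measure.restrict_restrict measurableSet_Iic,
          setIntegral_const, inter_comm, Ioc_inter_Iic, min_eq_right hx.2, smul_eq_mul, mul_comm]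
    _ = ∫ y in Ioc a b, (∫ x in Ioc a b, (Iic x).indicator (fun _ => f x) y) ∂ν := hswap
    _ = ∫ y in Ioc a b, (∫ x in y..b, f x) ∂ν := by
        refine setIntegral_congr_fun measurableSet_Ioc fun y hy => ?_
        have : (fun x => (Iic x).indicator (fun _ => f x) y) = (Ici y).indicator f := by
          ext x
          simp [indicator]
        rw [this, integral_indicator measurableSet_Ici, Measure.restrict_restrict measurableSet_Ici,
          intervalIntegral.integral_of_le hy.2, ← integral_Icc_eq_integral_Ioc]
        congr 2
        ext x
        simp only [mem_inter_iff, mem_Ici, mem_Ioc, mem_Icc]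
        exact ⟨fun h => ⟨h.1, h.2.2⟩, fun h => ⟨h.1, hy.1.trans_le h.1, h.2⟩⟩

theorem integrable_comp_sub_restrict_Ioc {ν : Measure ℝ} {a b : ℝ}
    [IsFiniteMeasure (ν.restrict (Ioc a b))] {g : ℝ → ℝ} (hg : Continuous g) (x : ℝ) :
    Integrable (fun y => g (x - y)) (ν.restrict (Ioc a b)) := by
  obtain ⟨C, hC⟩ := (isCompact_Icc (a := x - b) (b := x - a)).exists_bound_of_continuousOn
    hg.continuousOn
  refine Integrable.of_bound (hg.comp (continuous_sub_left x)).aestronglyMeasurable C ?_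
  filter_upwards [ae_restrict_mem measurableSet_Ioc] with y hy
  exact hC _ ⟨by linarith [hy.2], by linarith [hy.1]⟩

/-- Differentiation under the integral sign of the convolution of a primitive of `g` with a
measure. -/
theorem hasDerivAt_setIntegral_comp_sub {ν : Measure ℝ} {a b : ℝ}
    [IsFiniteMeasure (ν.restrict (Ioc a b))] {g G : ℝ → ℝ} (hg : Continuous g)
    (hG : ∀ x, HasDerivAt G (g x) x) (x : ℝ) :
    HasDerivAt (fun x => ∫ y in Ioc a b, G (x - y) ∂ν) (∫ y in Ioc a b, g (x - y) ∂ν) x := by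
  have hGc : Continuous G := continuous_iff_continuousAt.2 fun x => (hG x).continuousAt
  obtain ⟨C, hC⟩ := (isCompact_Icc (a := x - 1 - b) (b := x + 1 - a)).exists_bound_of_continuousOn
    hg.continuousOn
  refine (hasDerivAt_integral_of_dominated_loc_of_deriv_le (bound := fun _ => C)
    (F' := fun x y => g (x - y)) (Metric.ball_mem_nhds x one_pos)
    (Eventually.of_forall fun z => (hGc.comp (continuous_sub_left z)).aestronglyMeasurable)
    (integrable_comp_sub_restrict_Ioc hGc x) (hg.comp (continuous_sub_left x)).aestronglyMeasurable ?_ (integrable_const C) ?_).2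
  · filter_upwards [ae_restrict_mem measurableSet_Ioc] with y hy z hz
    rw [Metric.mem_ball, Real.dist_eq, abs_lt] at hz
    exact hC _ ⟨by linarith [hy.2, hz.1], by linarith [hy.1, hz.2]⟩
  · filter_upwards with y z _
    exact (hG (z - y)).comp_sub_const z y

theorem continuous_setIntegral_comp_sub {ν : Measure ℝ} {a b : ℝ}
    [IsFiniteMeasure (ν.restrict (Ioc a b))] {g : ℝ → ℝ} (hg : Continuous g) :
    Continuous fun x => ∫ y in Ioc a b, g (x - y) ∂ν := by
  have h := continuous_parametric_integral_of_continuous (μ := ν.restrict (Ioc a b))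
    (f := fun x y => g (x - y)) (by fun_prop) (isCompact_Icc (a := a) (b := b))
  rwa [Measure.restrict_restrict measurableSet_Icc,
    inter_eq_right.2 Ioc_subset_Icc_self] at h

/-- Integration by parts against a Stieltjes measure. -/
theorem integral_comp_sub_mul_eq_of_isStieltjesOf {ν : Measure ℝ} {g k : ℝ → ℝ} {a b : ℝ}
    (hab : a ≤ b) (hg : Continuous g) (hk : Monotone k) (hkc : Continuous k)
    (hν : IsStieltjesOf ν k) {G : ℝ → ℝ} (hG : ∀ x, HasDerivAt G (g x) x) (x : ℝ) :
    ∫ y in a..b, g (x - y) * k y =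
      k a * G (x - a) - k b * G (x - b) + ∫ y in Ioc a b, G (x - y) ∂ν := by
  have := isFiniteMeasure_restrict_Ioc_of_isStieltjesOf hν hab
  have hGc : Continuous G := continuous_iff_continuousAt.2 fun x => (hG x).continuousAt
  have hgx : Continuous fun y => g (x - y) := hg.comp (continuous_sub_left x)
  have hreal : ∀ y, a ≤ y → ν.real (Ioc a y) = k y - k a := fun y hy => by
    rw [measureReal_def, hν a y hy, ENNReal.toReal_ofReal (sub_nonneg.2 (hk hy))]
  have hprim : ∀ y, ∫ z in y..b, g (x - z) = G (x - y) - G (x - b) := fun y => by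
    rw [intervalIntegral.integral_comp_sub_left (fun z => g z) x]
    exact intervalIntegral.integral_eq_sub_of_hasDerivAt (fun z _ => hG z)
      (hg.intervalIntegrable _ _)
  have hsplit : ∫ y in a..b, g (x - y) * k y =
      k a * (∫ y in a..b, g (x - y)) + ∫ y in Ioc a b, g (x - y) * ν.real (Ioc a y) := by
    have h1 : ∫ y in Ioc a b, g (x - y) * ν.real (Ioc a y) =
        ∫ y in a..b, g (x - y) * (k y - k a) := by
      rw [intervalIntegral.integral_of_le hab]
      refine setIntegral_congr_fun measurableSet_Ioc fun y hy => ?_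
      simp only [hreal y hy.1.le]
    rw [h1, ← intervalIntegral.integral_const_mul, ← intervalIntegral.integral_add
      (Continuous.intervalIntegrable (by fun_prop) _ _)
      (Continuous.intervalIntegrable (by fun_prop) _ _)]
    exact intervalIntegral.integral_congr fun y _ => by ring
  have hGint : Integrable (fun y => G (x - y)) (ν.restrict (Ioc a b)) :=
    integrable_comp_sub_restrict_Ioc hGc x
  rw [hsplit, integral_mul_measureReal_Ioc hgx]
  simp only [hprim]
  rw [integral_sub hGint (integrable_const _), setIntegral_const, hreal b hab, smul_eq_mul]
  ring

theorem comp_add_eq_exp_mul_of_periodic {s ρ : ℝ → ℝ} {p T : ℝ} (hper : Function.Periodic s T)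
    (hform : ∀ τ, s τ = exp (-τ / p) * ρ τ) (x : ℝ) : ρ (x + T) = exp (T / p) * ρ x := by
  have h := hper x
  rw [hform, hform] at h
  have h2 : exp (-x / p) = exp (-(x + T) / p) * exp (T / p) := by
    rw [← exp_add]; congr 1; ring
  rw [h2, mul_assoc] at h
  exact mul_left_cancel₀ (exp_pos _).ne' h

theorem exp_mul_exp_sub_div (p η l : ℝ) :
    exp (-(η - l) / p) * exp (-l / p) = exp (-η / p) := by
  rw [← exp_add]; congr 1; ring

/-- for `s, s̃` with common period `T`, the function `s ⋆ s̃` is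
continuously differentiable and
`(s ⋆ s̃)'(η) = (1/T)∫_0^T s(η−λ) d(s̃(λ)) = −(1/p)(s ⋆ s̃)(η) + e^{−η/p}(1/T)∫_0^T ρ(η−λ) d(ρ̃(λ))`,
where `ν` is the Lebesgue–Stieltjes measure of `ρ̃` (the middle expression is written
out via the decomposition `d s̃(λ) = −(1/p) s̃(λ) dλ + e^{−λ/p} dρ̃(λ)`). -/
theorem stmt5 (p T : ℝ) (hp : 0 < p) (hT : 0 < T)
    (s st ρ ρt : ℝ → ℝ)
    (hs : Continuous s) (hst : Continuous st)
    (hsper : Function.Periodic s T) (hstper : Function.Periodic st T)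
    (hsb : ∃ m M : ℝ, 0 < m ∧ ∀ τ, m ≤ s τ ∧ s τ ≤ M)
    (hstb : ∃ m M : ℝ, 0 < m ∧ ∀ τ, m ≤ st τ ∧ st τ ≤ M)
    (hρ : Monotone ρ) (hρt : Monotone ρt)
    (hρc : Continuous ρ) (hρtc : Continuous ρt)
    (hsform : ∀ τ, s τ = Real.exp (-τ / p) * ρ τ)
    (hstform : ∀ τ, st τ = Real.exp (-τ / p) * ρt τ)
    (ν : MeasureTheory.Measure ℝ) (hν : IsStieltjesOf ν ρt) :
    (∀ η, HasDerivAt (periodConv s st T)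
        (-(1 / p) * periodConv s st T η +
          Real.exp (-η / p) * ((1 / T) * ∫ l in Set.Ioc (0:ℝ) T, ρ (η - l) ∂ν)) η) ∧
    Continuous (deriv (periodConv s st T)) ∧
    (∀ η, deriv (periodConv s st T) η =
        (1 / T) * ((∫ l in Set.Ioc (0:ℝ) T, s (η - l) * Real.exp (-l / p) ∂ν)
          - (1 / p) * ∫ l in (0:ℝ)..T, s (η - l) * st l)) := by
  have := isFiniteMeasure_restrict_Ioc_of_isStieltjesOf hν hT.le
  have hprim : ∀ x, HasDerivAt (fun x => ∫ u in (0:ℝ)..x, ρ u) (ρ x) x := fun x =>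
    (hρc.integral_hasStrictDerivAt 0 x).hasDerivAt
  have hconv : periodConv s st T =
      fun η => exp (-η / p) * ((1 / T) * ∫ l in (0:ℝ)..T, ρ (η - l) * ρt l) := by
    funext η
    rw [periodConv, mul_left_comm, ← intervalIntegral.integral_const_mul (exp (-η / p))]
    congr 1
    refine intervalIntegral.integral_congr fun l _ => ?_
    simp only [hsform, hstform, ← exp_mul_exp_sub_div p η l]
    ring
  have hderivρ : ∀ η, HasDerivAt (fun η => ∫ l in (0:ℝ)..T, ρ (η - l) * ρt l)
      (∫ l in Ioc (0:ℝ) T, ρ (η - l) ∂ν) η := by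
    intro η
    simp only [integral_comp_sub_mul_eq_of_isStieltjesOf hT.le hρc hρt hρtc hν hprim]
    have h := ((((hprim (η - 0)).comp_sub_const η 0).const_mul (ρt 0)).sub
      (((hprim (η - T)).comp_sub_const η T).const_mul (ρt T))).add
      (hasDerivAt_setIntegral_comp_sub (ν := ν) (a := 0) (b := T) hρc hprim η)
    refine h.congr_deriv ?_
    have h1 := comp_add_eq_exp_mul_of_periodic hstper hstform 0
    have h2 := comp_add_eq_exp_mul_of_periodic hsper hsform (η - T)
    rw [zero_add] at h1
    rw [sub_add_cancel] at h2
    rw [h1, sub_zero, h2]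
    ring
  have hderiv : ∀ η, HasDerivAt (periodConv s st T)
      (-(1 / p) * periodConv s st T η +
        exp (-η / p) * ((1 / T) * ∫ l in Ioc (0:ℝ) T, ρ (η - l) ∂ν)) η := by
    intro η
    rw [hconv]
    have hexp : HasDerivAt (fun η : ℝ => exp (-η / p)) (exp (-η / p) * (-1 / p)) η :=
      ((hasDerivAt_id η).neg.div_const p).exp
    refine (hexp.mul ((hderivρ η).const_mul (1 / T))).congr_deriv ?_
    ring
  have hcont : Continuous (periodConv s st T) :=
    continuous_iff_continuousAt.2 fun η => (hderiv η).continuousAt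
  refine ⟨hderiv, ?_, fun η => ?_⟩
  · rw [funext fun η => (hderiv η).deriv]
    have := continuous_setIntegral_comp_sub (ν := ν) (a := 0) (b := T) hρc
    fun_prop
  · have hst : ∫ l in Ioc (0:ℝ) T, s (η - l) * exp (-l / p) ∂ν =
        exp (-η / p) * ∫ l in Ioc (0:ℝ) T, ρ (η - l) ∂ν := by
      rw [← integral_const_mul]
      refine integral_congr_ae (Eventually.of_forall fun l => ?_)
      simp only [hsform, ← exp_mul_exp_sub_div p η l]
      ring
    rw [(hderiv η).deriv, hst, periodConv]
    ring
end
end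

section
/- Let (λ_n)_{n≥1} be a nonincreasing sequence of positive reals tending to 0 with counting function N(t) = #{n : λ_n > t}, and suppose N(t) ~ φ(1/t)·s(ln(1/t))/t^{1/p} as t → 0+, where p > 0, φ is an SVF and s is a continuous positive T-periodic function. Then s has the form s(τ) = e^{−τ/p}·ρ(τ) for some monotone function ρ; in particular, s is a function of bounded variation on every compact interval. -/
open MeasureTheory Filter Real Set Asymptotics

noncomputable section

/-- The counting function of a sequence tending to `0` is nonincreasing on `(0, ∞)`. -/
theorem cntF_antitoneOn {lam : ℕ → ℝ} (hlim : Tendsto lam atTop (nhds 0)) :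
    AntitoneOn (cntF lam) (Set.Ioi 0) := by
  intro t ht u _ htu
  have hfin : {n : ℕ | t < lam n}.Finite := by
    have h := hlim.eventually (eventually_le_nhds (show (0 : ℝ) < t from ht))
    rw [← Nat.cofinite_eq_atTop, eventually_cofinite] at h
    simpa using h
  exact Nat.cast_le.2 (Nat.card_mono hfin fun n hn => htu.trans_lt hn)

/-- Along the points `exp (-(τ + k * T))`, a function `N` with almost regular asymptotics,
normalized by `φ (exp (k * T)) * exp (k * T / p)`, recovers `exp (τ / p) * s τ`. -/
theorem tendsto_div_of_isEquivalent {p T : ℝ} (hT : 0 < T) {N φ s : ℝ → ℝ} (hφ : IsSVF φ)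
    (hspos : ∀ x, 0 < s x) (hsper : Function.Periodic s T)
    (hasymp : N ~[nhdsWithin (0 : ℝ) (Set.Ioi 0)]
      (fun t => φ (1 / t) * s (Real.log (1 / t)) / t ^ (1 / p))) (τ : ℝ) :
    Tendsto (fun k : ℕ => N (exp (-(τ + k * T))) / (φ (exp (k * T)) * exp (k * T / p)))
      atTop (nhds (exp (τ / p) * s τ)) := by
  have hk : Tendsto (fun k : ℕ => (k : ℝ) * T) atTop atTop :=
    tendsto_natCast_atTop_atTop.atTop_mul_const hT
  have ht : Tendsto (fun k : ℕ => exp (-(τ + k * T))) atTop (nhdsWithin 0 (Set.Ioi 0)) :=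
    tendsto_nhdsWithin_iff.2
      ⟨tendsto_exp_neg_atTop_nhds_zero.comp (tendsto_atTop_add_const_left _ τ hk),
        Eventually.of_forall fun k => exp_pos _⟩
  have hval : ∀ k : ℕ, φ (1 / exp (-(τ + k * T))) * s (Real.log (1 / exp (-(τ + k * T)))) /
      exp (-(τ + k * T)) ^ (1 / p) =
      φ (exp τ * exp (k * T)) * s τ * (exp (τ / p) * exp (k * T / p)) := by
    intro k
    have h1 : 1 / exp (-(τ + k * T)) = exp (τ + k * T) := by rw [exp_neg, one_div, inv_inv]
    have h2 : s (τ + k * T) = s τ := hsper.nat_mul k τ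
    rw [h1, log_exp, h2, ← exp_mul, div_eq_mul_inv, ← exp_neg, ← exp_add, ← exp_add]
    congr 2
    ring
  have hφpos : ∀ x, 0 < φ (exp x) := fun x => hφ.1 _ (exp_pos x)
  have hφpos' : ∀ k : ℕ, 0 < φ (exp τ * exp (k * T)) := fun k => hφ.1 _ (by positivity)
  have hratio := (isEquivalent_iff_tendsto_one (Eventually.of_forall fun k => ?_)).1
    (hasymp.comp_tendsto ht)
  · have hsv := (hφ.2 (exp τ) (exp_pos τ)).comp (tendsto_exp_atTop.comp hk)
    have h := (hratio.mul hsv).mul_const (exp (τ / p) * s τ)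
    rw [one_mul, one_mul] at h
    refine h.congr fun k => ?_
    have h1 := (hφpos' k).ne'
    have h2 := (hφpos (k * T)).ne'
    have h3 := (hspos τ).ne'
    simp only [Pi.div_apply, Function.comp_apply, hval]
    field_simp
  · simp only [Function.comp_apply, hval]
    have h1 := hφpos' k
    have h3 := hspos τ
    positivity

/-- The product of `exp (-τ / p)` and a monotone function is locally of bounded variation. -/
theorem locallyBoundedVariationOn_exp_mul {p : ℝ} (hp : 0 < p) {ρ : ℝ → ℝ} (hρ : Monotone ρ) :
    LocallyBoundedVariationOn (fun τ => exp (-τ / p) * ρ τ) Set.univ := by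
  have hmono : Monotone fun τ : ℝ => -exp (-τ / p) := fun a b hab => by
    dsimp only
    gcongr
  have hexp : LocallyBoundedVariationOn (fun τ : ℝ => exp (-τ / p)) Set.univ := by
    simpa [Function.comp_def] using LipschitzWith.id.neg.comp_locallyBoundedVariationOn
      (hmono.monotoneOn Set.univ).locallyBoundedVariationOn
  exact hexp.mul (hρ.monotoneOn Set.univ).locallyBoundedVariationOn

/-- if the counting function of a sequence has almost regular asymptotics
`N(t) ~ φ(1/t) s(ln(1/t)) / t^{1/p}` with `s` continuous, positive, `T`-periodic, then
`s(τ) = e^{−τ/p} ρ(τ)` for some monotone `ρ`; in particular `s` has locally bounded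
variation. -/
theorem stmt8 (p T : ℝ) (hp : 0 < p) (hT : 0 < T)
    (lam : ℕ → ℝ) (hpos : ∀ n, 0 < lam n) (hmono : Antitone lam)
    (hlim : Tendsto lam atTop (nhds 0))
    (φ s : ℝ → ℝ) (hφ : IsSVF φ)
    (hs : Continuous s) (hspos : ∀ x, 0 < s x) (hsper : Function.Periodic s T)
    (hasymp : cntF lam ~[nhdsWithin (0:ℝ) (Set.Ioi 0)]
      (fun t => φ (1 / t) * s (Real.log (1 / t)) / t ^ (1 / p))) :
    ∃ ρ : ℝ → ℝ, (Monotone ρ ∨ Antitone ρ) ∧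
      (∀ τ, s τ = Real.exp (-τ / p) * ρ τ) ∧
      LocallyBoundedVariationOn s Set.univ := by
  have hρ : Monotone fun τ => exp (τ / p) * s τ := by
    intro a b hab
    refine le_of_tendsto_of_tendsto' (tendsto_div_of_isEquivalent hT hφ hspos hsper hasymp a)
      (tendsto_div_of_isEquivalent hT hφ hspos hsper hasymp b) fun k => ?_
    have hden : 0 < φ (exp (k * T)) := hφ.1 _ (exp_pos _)
    have hle : cntF lam (exp (-(a + k * T))) ≤ cntF lam (exp (-(b + k * T))) :=
      cntF_antitoneOn hlim (exp_pos _) (exp_pos _) (by gcongr)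
    gcongr
  have hs_eq : ∀ τ, s τ = exp (-τ / p) * (exp (τ / p) * s τ) := fun τ => by
    rw [← mul_assoc, ← exp_add, neg_div, neg_add_cancel, exp_zero, one_mul]
  refine ⟨_, Or.inl hρ, hs_eq, ?_⟩
  rw [funext hs_eq]
  exact locallyBoundedVariationOn_exp_mul hp hρ
end
end

section
/- Let (λ_n) and (λ̃_k) be nonincreasing summable sequences of positive reals with counting functions N and Ñ, and let N_⊗(t) = #{(k, j) : λ_k·λ̃_j > t} = Σ_k N(t/λ̃_k). Suppose N(t) ~ φ(1/t)·s(ln(1/t))/t^{1/p} as t → 0+, where p > 0, φ is an SVF, s is a continuous positive T-periodic function, and suppose Ñ(t) = O(t^{−1/p̃}) as t → 0+ for some p̃ > p. Then N_⊗(t) ~ φ(1/t)·s*(ln(1/t))/t^{1/p} as t → 0+, where s*(τ) = Σ_k s(τ + ln λ̃_k)·λ̃_k^{1/p} is a T-periodic function (the series converges since p̃ > p). -/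
open MeasureTheory Filter Real Set Asymptotics

noncomputable section

/-- A continuous positive periodic function is bounded above and away from zero. -/
lemma Function.Periodic.exists_pos_bounds {s : ℝ → ℝ} {T : ℝ} (hper : Function.Periodic s T)
    (hT : 0 < T) (hs : Continuous s) (hpos : ∀ x, 0 < s x) :
    ∃ m M : ℝ, 0 < m ∧ 0 < M ∧ ∀ x, m ≤ s x ∧ s x ≤ M := by
  have hne : (Set.Icc 0 T).Nonempty := Set.nonempty_Icc.2 hT.le
  obtain ⟨x₀, -, h₀⟩ := isCompact_Icc.exists_isMinOn hne hs.continuousOn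
  obtain ⟨x₁, -, h₁⟩ := isCompact_Icc.exists_isMaxOn hne hs.continuousOn
  refine ⟨s x₀, s x₁, hpos _, hpos _, fun x => ?_⟩
  obtain ⟨y, hy, hxy⟩ := hper.exists_mem_Ico₀ hT x
  rw [hxy]
  exact ⟨h₀ (Set.Ico_subset_Icc_self hy), h₁ (Set.Ico_subset_Icc_self hy)⟩

lemma finite_setOf_lt_of_summable {u : ℕ → ℝ} (hu : Summable u) {t : ℝ} (ht : 0 < t) :
    {n | t < u n}.Finite := by
  have h := hu.tendsto_cofinite_zero.eventually (gt_mem_nhds ht)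
  exact (Filter.eventually_cofinite.1 h).subset fun n hn => not_lt.2 (le_of_lt hn)

lemma cntF_antitoneOn_s9 {u : ℕ → ℝ} (hu : Summable u) : AntitoneOn (cntF u) (Set.Ioi 0) := by
  intro a ha b _ hab
  exact Nat.cast_le.2 (Nat.card_mono (finite_setOf_lt_of_summable hu ha)
    fun n (hn : b < u n) => hab.trans_lt hn)

lemma cntF_eq_zero {u : ℕ → ℝ} (hu : Antitone u) {t : ℝ} (ht : u 0 ≤ t) : cntF u t = 0 := by
  have : {n : ℕ | t < u n} = ∅ :=
    Set.eq_empty_of_forall_notMem fun n hn => absurd hn (not_lt.2 ((hu n.zero_le).trans ht))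
  simp [cntF, this]

lemma natCast_succ_le_cntF {u : ℕ → ℝ} (hu : Summable u) (hanti : Antitone u) {t : ℝ}
    (ht : 0 < t) {k : ℕ} (hk : t < u k) : (k : ℝ) + 1 ≤ cntF u t := by
  have h := Nat.card_mono (finite_setOf_lt_of_summable hu ht)
    (show Set.Iic k ⊆ {n | t < u n} from fun n hn => hk.trans_le (hanti hn))
  have h' : Nat.card (Set.Iic k) = k + 1 := by simp
  rw [h'] at h
  rw [cntF]
  exact_mod_cast h

/-- A power bound on the counting function makes high enough powers of the sequence summable. -/
lemma summable_rpow_of_cntF_isBigO {u : ℕ → ℝ} (hpos : ∀ n, 0 < u n) (hanti : Antitone u)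
    (hu : Summable u) {r q : ℝ} (hr : 0 < r) (hrq : r < q)
    (hO : cntF u =O[nhdsWithin (0 : ℝ) (Set.Ioi 0)] fun t => t ^ (-r)) :
    Summable fun k => u k ^ q := by
  obtain ⟨C, hC, hb⟩ := hO.exists_pos
  have hlim : Tendsto (fun k => u k / 2) atTop (nhdsWithin (0 : ℝ) (Set.Ioi 0)) := by
    refine tendsto_nhdsWithin_iff.2 ⟨by simpa using hu.tendsto_atTop_zero.div_const 2, ?_⟩
    exact Eventually.of_forall fun k => half_pos (hpos k)
  have hev := hlim.eventually hb.bound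
  have hq : 0 < q := hr.trans hrq
  have hS : Summable fun k : ℕ => (2 ^ q * C ^ (q / r)) * (1 / ((k : ℝ) + 1) ^ (q / r)) := by
    refine Summable.mul_left _ ?_
    have := (summable_nat_add_iff 1).2 (Real.summable_one_div_nat_rpow.2 ((one_lt_div hr).2 hrq))
    simpa using this
  refine hS.of_norm_bounded_eventually_nat ?_
  filter_upwards [hev] with k hk
  have hh : 0 < u k / 2 := half_pos (hpos k)
  have h1 := natCast_succ_le_cntF hu hanti hh (half_lt_self (hpos k))
  have hk1 : (0 : ℝ) < (k : ℝ) + 1 := by positivity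
  have h2 : (k : ℝ) + 1 ≤ C * (u k / 2) ^ (-r) := by
    refine h1.trans ((le_abs_self _).trans ?_)
    simpa [abs_of_pos (Real.rpow_pos_of_pos hh _)] using hk
  have h3 : (u k / 2) ^ r ≤ C / ((k : ℝ) + 1) := by
    rw [le_div_iff₀ hk1]
    rw [Real.rpow_neg hh.le, ← div_eq_mul_inv, le_div_iff₀ (Real.rpow_pos_of_pos hh _)] at h2
    linarith
  have h4 := Real.rpow_le_rpow (Real.rpow_nonneg hh.le _) h3 (div_pos hq hr).le
  rw [← Real.rpow_mul hh.le, mul_div_cancel₀ q hr.ne', Real.div_rpow hC.le hk1.le,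
    Real.div_rpow (hpos k).le two_pos.le, div_le_iff₀ (by positivity)] at h4
  rw [Real.norm_of_nonneg (Real.rpow_nonneg (hpos k).le _)]
  calc u k ^ q ≤ _ := h4
    _ = _ := by ring

/-- The counting function of the products is the sum of rescaled counting functions. -/
lemma cntTensor_eq_tsum {u v : ℕ → ℝ} (hu : Summable u) (hv : Summable v)
    (hupos : ∀ n, 0 < u n) (hvpos : ∀ n, 0 < v n) (huanti : Antitone u) (hvanti : Antitone v)
    {t : ℝ} (ht : 0 < t) : cntTensor u v t = ∑' k, cntF u (t / v k) := by
  have hcard : ∀ {α : Type} (A : Set α), (Nat.card A : ℝ) = ∑' a, A.indicator 1 a := by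
    intro α A
    rw [← tsum_subtype A]
    simp
  have hfin : {q : ℕ × ℕ | t < u q.1 * v q.2}.Finite := by
    refine ((finite_setOf_lt_of_summable hu (div_pos ht (hvpos 0))).prod
      (finite_setOf_lt_of_summable hv (div_pos ht (hupos 0)))).subset ?_
    intro q hq
    have hq' : t < u q.1 * v q.2 := hq
    refine ⟨(div_lt_iff₀ (hvpos 0)).2 (hq'.trans_le ?_), (div_lt_iff₀ (hupos 0)).2
      (hq'.trans_le ?_)⟩
    · exact mul_le_mul_of_nonneg_left (hvanti q.2.zero_le) (hupos _).le
    · rw [mul_comm]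
      exact mul_le_mul_of_nonneg_left (huanti q.1.zero_le) (hvpos _).le
  set S := {q : ℕ × ℕ | t < u q.1 * v q.2}
  have hsum : Summable (S.indicator (1 : ℕ × ℕ → ℝ)) :=
    summable_of_hasFiniteSupport (hfin.subset Set.support_indicator_subset)
  have hcomm : ∑' q, S.indicator (1 : ℕ × ℕ → ℝ) q
      = ∑' k, ∑' n, S.indicator (1 : ℕ × ℕ → ℝ) (n, k) := by
    rw [← (Equiv.prodComm ℕ ℕ).tsum_eq]
    exact ((Equiv.prodComm ℕ ℕ).summable_iff.2 hsum).tsum_prod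
  rw [cntTensor, hcard, hcomm]
  refine tsum_congr fun k => ?_
  rw [cntF, hcard]
  refine tsum_congr fun n => ?_
  simp [S, Set.indicator_apply, div_lt_iff₀ (hvpos k)]

lemma pow_mul_le_of_doubling {H : ℝ → ℝ} {b X : ℝ} (hb : 0 ≤ b) (hX : 0 < X)
    (hH : ∀ x, X ≤ x → b * H x ≤ H (2 * x)) (n : ℕ) {x : ℝ} (hx : X ≤ x) :
    b ^ n * H x ≤ H (2 ^ n * x) := by
  induction n with
  | zero => simp
  | succ n ih =>
    have hx' : X ≤ 2 ^ n * x :=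
      hx.trans (le_mul_of_one_le_left (hX.le.trans hx) (one_le_pow₀ one_le_two))
    calc b ^ (n + 1) * H x = b * (b ^ n * H x) := by ring
      _ ≤ b * H (2 ^ n * x) := mul_le_mul_of_nonneg_left ih hb
      _ ≤ H (2 * (2 ^ n * x)) := hH _ hx'
      _ = H (2 ^ (n + 1) * x) := by ring_nf

/-- A Potter-type bound for a monotone function comparable to one with a doubling lower bound. -/
lemma MonotoneOn.mul_div_rpow_le {G H : ℝ → ℝ} {q c C X : ℝ} (hq : 0 < q) (hc : 0 < c)
    (hC : 0 < C) (hX : 0 < X) (hG : MonotoneOn G (Set.Ioi 0))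
    (hlow : ∀ x, X ≤ x → c * H x ≤ G x) (hup : ∀ x, X ≤ x → G x ≤ C * H x)
    (hgrow : ∀ x, X ≤ x → 2 ^ q * H x ≤ H (2 * x)) (hHpos : ∀ x, 0 < x → 0 < H x)
    {x y : ℝ} (hy : X ≤ y) (hyx : y ≤ x) :
    G y * (x / y) ^ q ≤ 2 ^ q * C ^ 2 / c * H x := by
  have hy0 : 0 < y := hX.trans_le hy
  have hx0 : 0 < x := hy0.trans_le hyx
  obtain ⟨n, hn, hn'⟩ := exists_nat_pow_near ((one_le_div hy0).2 hyx) one_lt_two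
  have hny : 2 ^ n * y ≤ x := (le_div_iff₀ hy0).1 hn
  have hyn : y ≤ 2 ^ n * y := le_mul_of_one_le_left hy0.le (one_le_pow₀ one_le_two)
  have h2 : (0 : ℝ) < 2 ^ q := by positivity
  have h1 := pow_mul_le_of_doubling h2.le hX hgrow n hy
  have h3 : c * H (2 ^ n * y) ≤ C * H x :=
    (hlow _ (hy.trans hyn)).trans
      ((hG (hy0.trans_le hyn) hx0 hny).trans (hup _ (hy.trans hyx)))
  have h4 : (x / y) ^ q ≤ 2 ^ q * (2 ^ q) ^ n := by
    calc (x / y) ^ q ≤ (2 ^ (n + 1)) ^ q :=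
          Real.rpow_le_rpow (div_pos hx0 hy0).le hn'.le hq.le
      _ = (2 ^ q) ^ (n + 1) := (Real.rpow_pow_comm zero_le_two q (n + 1)).symm
      _ = _ := by ring
  have h5 : H (2 ^ n * y) ≤ C / c * H x := by
    rw [div_mul_eq_mul_div, le_div_iff₀ hc]
    linarith
  calc G y * (x / y) ^ q ≤ (C * H y) * (2 ^ q * (2 ^ q) ^ n) :=
        mul_le_mul (hup y hy) h4 (by positivity) (mul_pos hC (hHpos y hy0)).le
    _ = C * 2 ^ q * ((2 ^ q) ^ n * H y) := by ring
    _ ≤ C * 2 ^ q * (C / c * H x) :=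
        mul_le_mul_of_nonneg_left (h1.trans h5) (mul_pos hC h2).le
    _ = _ := by ring

lemma MonotoneOn.exists_forall_mul_le_rpow_mul {G H : ℝ → ℝ} {q a c C : ℝ} (hq : 0 < q)
    (ha : 0 < a) (hc : 0 < c) (hC : 0 < C) (hG : MonotoneOn G (Set.Ioi 0))
    (hGz : ∀ x, 0 < x → x ≤ a → G x = 0) (hHpos : ∀ x, 0 < x → 0 < H x)
    (hlow : ∀ᶠ x in atTop, c * H x ≤ G x) (hup : ∀ᶠ x in atTop, G x ≤ C * H x)
    (hgrow : ∀ᶠ x in atTop, 2 ^ q * H x ≤ H (2 * x)) :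
    ∃ K, 0 < K ∧ ∀ᶠ x in atTop, ∀ l, 0 < l → l ≤ 1 → G (l * x) ≤ K * l ^ q * H x := by
  obtain ⟨X, hXa, hX⟩ := (atTop_basis' a).eventually_iff.1 (hlow.and (hup.and hgrow))
  have hX0 : 0 < X := ha.trans_le hXa
  have key : ∀ {x y : ℝ}, X ≤ y → y ≤ x → G y * (x / y) ^ q ≤ 2 ^ q * C ^ 2 / c * H x :=
    hG.mul_div_rpow_le hq hc hC hX0 (fun x hx => (hX hx).1) (fun x hx => (hX hx).2.1)
      (fun x hx => (hX hx).2.2) hHpos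
  set K₀ := 2 ^ q * C ^ 2 / c with hK₀
  have hK₀pos : 0 < K₀ := by positivity
  have hXa1 : 1 ≤ (X / a) ^ q := Real.one_le_rpow ((one_le_div ha).2 hXa) hq.le
  refine ⟨K₀ * (X / a) ^ q, by positivity, ?_⟩
  filter_upwards [eventually_ge_atTop X] with x hx l hl hl1
  have hx0 : 0 < x := hX0.trans_le hx
  have hlx : 0 < l * x := mul_pos hl hx0
  have hlq : 0 < l ^ q := Real.rpow_pos_of_pos hl q
  have hH := hHpos x hx0
  suffices h : G (l * x) * (1 / l) ^ q ≤ K₀ * (X / a) ^ q * H x by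
    rw [Real.div_rpow zero_le_one hl.le, Real.one_rpow, mul_one_div, div_le_iff₀ hlq] at h
    linarith
  rcases le_total X (l * x) with h | h
  · have h1 := key h (mul_le_of_le_one_left hx0.le hl1)
    rw [show x / (l * x) = 1 / l by field_simp] at h1
    refine h1.trans ?_
    gcongr
    exact le_mul_of_one_le_right hK₀pos.le hXa1
  rcases le_total (l * x) a with h' | h'
  · rw [hGz _ hlx h', zero_mul]
    positivity
  · have h1 := key le_rfl hx
    have hGX : 0 ≤ G X := by
      have := hG ha hX0 hXa
      rwa [hGz a ha le_rfl] at this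
    have h2 : (1 / l) ^ q ≤ (x / X) ^ q * (X / a) ^ q := by
      rw [← Real.mul_rpow (by positivity) (by positivity)]
      refine Real.rpow_le_rpow (by positivity) ?_ hq.le
      rw [div_mul_div_cancel₀ hX0.ne', div_le_div_iff₀ hl ha]
      linarith
    calc G (l * x) * (1 / l) ^ q ≤ G X * ((x / X) ^ q * (X / a) ^ q) :=
          mul_le_mul (hG hlx hX0 h) h2 (by positivity) hGX
      _ = G X * (x / X) ^ q * (X / a) ^ q := by ring
      _ ≤ K₀ * H x * (X / a) ^ q := by gcongr
      _ = _ := by ring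

/-- `x ↦ φ(x) x^α` with `φ` slowly varying is regularly varying of index `α`. -/
lemma IsSVF.tendsto_mul_rpow_div {φ : ℝ → ℝ} (hφ : IsSVF φ) (α : ℝ) {l : ℝ} (hl : 0 < l) :
    Tendsto (fun x => φ (l * x) * (l * x) ^ α / (φ x * x ^ α)) atTop (nhds (l ^ α)) := by
  have h := (hφ.2 l hl).mul_const (l ^ α)
  rw [one_mul] at h
  refine h.congr' ?_
  filter_upwards [eventually_gt_atTop 0] with x hx
  have h1 := hφ.1 x hx
  have h2 : 0 < x ^ α := Real.rpow_pos_of_pos hx α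
  rw [Real.mul_rpow hl.le hx.le]
  field_simp

/-- Sums of rescalings of a monotone function asymptotic to a log-periodic multiple of a regularly
varying function. -/
lemma isEquivalent_tsum_rescaled {G φ s : ℝ → ℝ} {v : ℕ → ℝ} {α q a m M : ℝ} (hq : 0 < q)
    (hqα : q < α) (ha : 0 < a) (hφ : IsSVF φ) (hG : MonotoneOn G (Set.Ioi 0))
    (hGz : ∀ x, 0 < x → x ≤ a → G x = 0) (hm : 0 < m) (hM : 0 < M)
    (hs : ∀ x, m ≤ s x ∧ s x ≤ M) (hv : ∀ n, 0 < v n) (hvanti : Antitone v)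
    (hvq : Summable fun k => v k ^ q) (hvα : Summable fun k => v k ^ α)
    (hGs : G ~[atTop] fun x => φ x * s (Real.log x) * x ^ α) :
    (fun x => ∑' k, G (v k * x)) ~[atTop]
      fun x => φ x * (∑' k, s (Real.log x + Real.log (v k)) * v k ^ α) * x ^ α := by
  set H : ℝ → ℝ := fun x => φ x * x ^ α with hH
  have hHpos : ∀ x, 0 < x → 0 < H x := fun x hx => mul_pos (hφ.1 x hx) (Real.rpow_pos_of_pos hx α)
  have hHlim : ∀ l, 0 < l → Tendsto (fun x => H (l * x) / H x) atTop (nhds (l ^ α)) :=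
    fun l hl => hφ.tendsto_mul_rpow_div α hl
  have hspos : ∀ x, 0 < s x := fun x => hm.trans_le (hs x).1
  have hratio : Tendsto (fun x => G x / (H x * s (Real.log x))) atTop (nhds 1) := by
    have hne : ∀ᶠ x in atTop, φ x * s (Real.log x) * x ^ α ≠ 0 := by
      filter_upwards [eventually_gt_atTop 0] with x hx
      exact (mul_pos (mul_pos (hφ.1 x hx) (hspos _)) (Real.rpow_pos_of_pos hx α)).ne'
    refine ((isEquivalent_iff_tendsto_one hne).1 hGs).congr fun x => ?_
    simp only [hH, Pi.div_apply]
    rw [mul_right_comm]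
  have hG0 : ∀ x, 0 < x → 0 ≤ G x := fun x hx => by
    rcases le_total x a with h | h
    · exact (hGz x hx h).ge
    · exact (hGz a ha le_rfl).ge.trans (hG ha hx h)
  obtain ⟨K, hK, hpot⟩ : ∃ K, 0 < K ∧
      ∀ᶠ x in atTop, ∀ l, 0 < l → l ≤ 1 → G (l * x) ≤ K * l ^ q * H x := by
    refine hG.exists_forall_mul_le_rpow_mul (c := m / 2) (C := 2 * M) hq ha (by positivity)
      (by positivity) hGz hHpos ?_ ?_ ?_
    · filter_upwards [eventually_gt_atTop 0,
        hratio.eventually (lt_mem_nhds (show (1 / 2 : ℝ) < 1 by norm_num))] with x hx h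
      have hHx := hHpos x hx
      rw [lt_div_iff₀ (mul_pos hHx (hspos _))] at h
      nlinarith [mul_le_mul_of_nonneg_left (hs (Real.log x)).1 hHx.le]
    · filter_upwards [eventually_gt_atTop 0,
        hratio.eventually (gt_mem_nhds (show (1 : ℝ) < 2 by norm_num))] with x hx h
      have hHx := hHpos x hx
      rw [div_lt_iff₀ (mul_pos hHx (hspos _))] at h
      nlinarith [mul_le_mul_of_nonneg_left (hs (Real.log x)).2 hHx.le]
    · filter_upwards [eventually_gt_atTop 0, (hHlim 2 two_pos).eventually
        (lt_mem_nhds (Real.rpow_lt_rpow_of_exponent_lt one_lt_two hqα))] with x hx h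
      exact ((lt_div_iff₀ (hHpos x hx)).1 h).le
  set L := v 0 with hL
  have hL0 : 0 < L := hv 0
  have hdom : ∀ᶠ x in atTop, ∀ k,
      G (v k * x) / H x ≤ K * (L ^ α + 1) / L ^ q * v k ^ q := by
    filter_upwards [eventually_gt_atTop 0, (tendsto_id.const_mul_atTop hL0).eventually hpot,
      (hHlim L hL0).eventually (gt_mem_nhds (lt_add_one (L ^ α)))] with x hx h1 h2 k
    have hLq : 0 < L ^ q := Real.rpow_pos_of_pos hL0 q
    have hvkq : 0 < v k ^ q := Real.rpow_pos_of_pos (hv k) q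
    have h3 := h1 (v k / L) (div_pos (hv k) hL0) ((div_le_one hL0).2 (hvanti k.zero_le))
    rw [id, show v k / L * (L * x) = v k * x by field_simp,
      Real.div_rpow (hv k).le hL0.le] at h3
    rw [div_lt_iff₀ (hHpos x hx)] at h2
    rw [div_le_iff₀ (hHpos x hx)]
    calc G (v k * x) ≤ K * (v k ^ q / L ^ q) * H (L * x) := h3
      _ ≤ K * (v k ^ q / L ^ q) * ((L ^ α + 1) * H x) := by gcongr
      _ = _ := by ring
  have hterm : ∀ x k, |s (Real.log x + Real.log (v k)) * v k ^ α| ≤ M * v k ^ α := fun x k => by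
    have hvk : 0 < v k ^ α := Real.rpow_pos_of_pos (hv k) α
    rw [abs_of_pos (mul_pos (hspos _) hvk)]
    exact mul_le_mul_of_nonneg_right (hs _).2 hvk.le
  have hSsum : ∀ x, Summable fun k => s (Real.log x + Real.log (v k)) * v k ^ α :=
    fun x => (hvα.mul_left M).of_norm_bounded (hterm x)
  have hdom' : ∀ᶠ x in atTop, ∀ k,
      |G (v k * x) / H x| ≤ K * (L ^ α + 1) / L ^ q * v k ^ q := by
    filter_upwards [eventually_gt_atTop 0, hdom] with x hx h k
    rw [abs_of_nonneg (div_nonneg (hG0 _ (mul_pos (hv k) hx)) (hHpos x hx).le)]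
    exact h k
  have hdiff : Tendsto (fun x => ∑' k, (G (v k * x) / H x
      - s (Real.log x + Real.log (v k)) * v k ^ α)) atTop (nhds 0) := by
    rw [← tsum_zero (α := ℝ) (β := ℕ)]
    refine tendsto_tsum_of_dominated_convergence
      (bound := fun k => K * (L ^ α + 1) / L ^ q * v k ^ q + M * v k ^ α)
      ((hvq.mul_left _).add (hvα.mul_left _)) (fun k => ?_) ?_
    · have h1 : Tendsto (fun x => G (v k * x) / (H (v k * x) * s (Real.log (v k * x)))
          * (H (v k * x) / H x) - v k ^ α) atTop (nhds 0) := by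
        have := ((hratio.comp (tendsto_id.const_mul_atTop (hv k))).mul
          (hHlim (v k) (hv k))).sub_const (v k ^ α)
        simpa [Function.comp_def] using this
      have h2 : IsBoundedUnder (· ≤ ·) atTop
          ((‖·‖) ∘ fun x => s (Real.log x + Real.log (v k))) :=
        isBoundedUnder_of ⟨M, fun x => by
          simpa [abs_of_pos (hspos _)] using (hs (Real.log x + Real.log (v k))).2⟩
      refine (h1.zero_mul_isBoundedUnder_le h2).congr' ?_
      filter_upwards [eventually_gt_atTop 0] with x hx
      have e1 := (hHpos x hx).ne'
      have e2 := (hHpos _ (mul_pos (hv k) hx)).ne'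
      have e3 := (hspos (Real.log x + Real.log (v k))).ne'
      rw [Real.log_mul (hv k).ne' hx.ne', add_comm (Real.log (v k))]
      field_simp
    · filter_upwards [hdom'] with x h k
      exact (abs_sub _ _).trans (add_le_add (h k) (hterm x k))
  have hlower : ∀ x, m * ∑' k, v k ^ α ≤ ∑' k, s (Real.log x + Real.log (v k)) * v k ^ α :=
    fun x => by
      rw [← tsum_mul_left]
      exact (hvα.mul_left m).tsum_le_tsum (fun k => mul_le_mul_of_nonneg_right (hs _).1
        (Real.rpow_nonneg (hv k).le α)) (hSsum x)
  have hb : 0 < m * ∑' k, v k ^ α :=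
    mul_pos hm (hvα.tsum_pos (fun k => Real.rpow_nonneg (hv k).le α) 0
      (Real.rpow_pos_of_pos (hv 0) α))
  have hSpos : ∀ x, 0 < ∑' k, s (Real.log x + Real.log (v k)) * v k ^ α :=
    fun x => hb.trans_le (hlower x)
  have hinv : IsBoundedUnder (· ≤ ·) atTop
      ((‖·‖) ∘ fun x => (∑' k, s (Real.log x + Real.log (v k)) * v k ^ α)⁻¹) :=
    isBoundedUnder_of ⟨(m * ∑' k, v k ^ α)⁻¹, fun x => by
      rw [Function.comp_apply, Real.norm_of_nonneg (inv_nonneg.2 (hSpos x).le)]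
      exact inv_anti₀ hb (hlower x)⟩
  refine (isEquivalent_iff_tendsto_one ?_).2 ?_
  · filter_upwards [eventually_gt_atTop 0] with x hx
    exact (mul_pos (mul_pos (hφ.1 x hx) (hSpos x)) (Real.rpow_pos_of_pos hx α)).ne'
  have hlim := (hdiff.zero_mul_isBoundedUnder_le hinv).add_const 1
  rw [zero_add] at hlim
  refine hlim.congr' ?_
  filter_upwards [eventually_gt_atTop 0, hdom'] with x hx h
  have hGsum : Summable fun k => G (v k * x) / H x := (hvq.mul_left _).of_norm_bounded h
  have e1 := (hφ.1 x hx).ne'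
  have e2 := (Real.rpow_pos_of_pos hx α).ne'
  have e3 := (hSpos x).ne'
  rw [hGsum.tsum_sub (hSsum x), tsum_div_const, Pi.div_apply, hH]
  generalize ∑' k, G (v k * x) = A
  field_simp
  ring

/-- Theorem 1: if `N(t) ~ φ(1/t) s(ln(1/t))/t^{1/p}` and
`Ñ(t) = O(t^{−1/p̃})` with `p̃ > p`, then
`N_⊗(t) ~ φ(1/t) s*(ln(1/t))/t^{1/p}` where
`s*(τ) = Σ_k s(τ + ln λ̃_k) λ̃_k^{1/p}` is `T`-periodic and the series converges. -/
theorem stmt9 (p pt T : ℝ) (hp : 0 < p) (hppt : p < pt) (hT : 0 < T)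
    (lam lamt : ℕ → ℝ)
    (hpos : ∀ n, 0 < lam n) (hpost : ∀ n, 0 < lamt n)
    (hmono : Antitone lam) (hmonot : Antitone lamt)
    (hsum : Summable lam) (hsumt : Summable lamt)
    (φ s : ℝ → ℝ) (hφ : IsSVF φ)
    (hs : Continuous s) (hspos : ∀ x, 0 < s x) (hsper : Function.Periodic s T)
    (hN : cntF lam ~[nhdsWithin (0:ℝ) (Set.Ioi 0)]
      (fun t => φ (1 / t) * s (Real.log (1 / t)) / t ^ (1 / p)))
    (hNt : cntF lamt =O[nhdsWithin (0:ℝ) (Set.Ioi 0)] (fun t => t ^ (-(1 / pt)))) :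
    (∀ τ : ℝ, Summable (fun k => s (τ + Real.log (lamt k)) * lamt k ^ (1 / p))) ∧
    Function.Periodic
      (fun τ => ∑' k, s (τ + Real.log (lamt k)) * lamt k ^ (1 / p)) T ∧
    cntTensor lam lamt ~[nhdsWithin (0:ℝ) (Set.Ioi 0)]
      (fun t => φ (1 / t) *
        (∑' k, s (Real.log (1 / t) + Real.log (lamt k)) * lamt k ^ (1 / p)) /
          t ^ (1 / p)) := by
  have hp1 : 0 < 1 / p := one_div_pos.2 hp
  have hpt1 : 0 < 1 / pt := one_div_pos.2 (hp.trans hppt)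
  have hlt : 1 / pt < 1 / p := one_div_lt_one_div_of_lt hp hppt
  obtain ⟨q, hq1, hq2⟩ := exists_between hlt
  obtain ⟨m, M, hm, hM, hbd⟩ := hsper.exists_pos_bounds hT hs hspos
  have hvq : ∀ q, 1 / pt < q → Summable fun k => lamt k ^ q := fun q hq =>
    summable_rpow_of_cntF_isBigO hpost hmonot hsumt hpt1 hq hNt
  refine ⟨fun τ => ?_, fun τ => ?_, ?_⟩
  · refine ((hvq _ hlt).mul_left M).of_nonneg_of_le (fun k => ?_) (fun k => ?_)
    · exact mul_nonneg (hspos _).le (Real.rpow_nonneg (hpost k).le _)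
    · exact mul_le_mul_of_nonneg_right (hbd _).2 (Real.rpow_nonneg (hpost k).le _)
  · refine tsum_congr fun k => ?_
    rw [add_right_comm, hsper]
  have hG : MonotoneOn (fun x => cntF lam (1 / x)) (Set.Ioi 0) := fun x hx y hy hxy =>
    cntF_antitoneOn_s9 hsum (Set.mem_Ioi.2 (one_div_pos.2 hy)) (Set.mem_Ioi.2 (one_div_pos.2 hx))
      (one_div_le_one_div_of_le hx hxy)
  have hGz : ∀ x, 0 < x → x ≤ 1 / lam 0 → cntF lam (1 / x) = 0 := fun x hx hxl =>
    cntF_eq_zero hmono ((le_one_div hx (hpos 0)).1 hxl)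
  have hGs : (fun x => cntF lam (1 / x)) ~[atTop]
      fun x => φ x * s (Real.log x) * x ^ (1 / p) := by
    refine (hN.comp_tendsto tendsto_inv_atTop_nhdsGT_zero).congr_left ?_ |>.congr_right ?_
    · exact Eventually.of_forall fun x => by simp
    · filter_upwards [eventually_gt_atTop 0] with x hx
      simp [Real.inv_rpow hx.le]
  have hmain := isEquivalent_tsum_rescaled (hpt1.trans hq1) hq2 (one_div_pos.2 (hpos 0)) hφ hG hGz
    hm hM hbd hpost hmonot (hvq q hq1) (hvq _ hlt) hGs
  refine ((hmain.comp_tendsto tendsto_inv_nhdsGT_zero).congr_left ?_).congr_right ?_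
  · filter_upwards [self_mem_nhdsWithin] with t ht
    rw [cntTensor_eq_tsum hsum hsumt hpos hpost hmono hmonot ht]
    refine tsum_congr fun k => ?_
    congr 1
    field_simp
  · filter_upwards [self_mem_nhdsWithin] with t ht
    simp [Real.inv_rpow (le_of_lt ht), div_eq_mul_inv]
end
end
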